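/- arXiv:1003.2272 — 7 statements merged into one kernel-verified Lean document; each statement's English description precedes it below -/
import Mathlib

section
/- Let B be a finite set and n ≥ 2, let H ≤ Sym(B) and X ≤ S_n both be 2-transitive, and let T be a minimal normal subgroup of H. If G ≤ H ≀ X has component H, the projection of G to S_n equals X, and G contains the base subgroup T^n (all permutations (b,i) ↦ (b^{t_i}, i) with t_1,…,t_n ∈ T), then G has rank 3 on B × {1,…,n}. -/
/-- The subgroup `K ≤ Sym(α)` is `2`-transitive on `α` (acting on at least two points). -/
def Is2Trans {α : Type*} (K : Subgroup (Equiv.Perm α)) : Prop :=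
  Nontrivial α ∧ ∀ a b c d : α, a ≠ b → c ≠ d → ∃ g ∈ K, g a = c ∧ g b = d

/-- Membership in the imprimitive wreath product `H ≀ X ≤ Sym(α × ι)`:
`g` has the form `(b, i) ↦ (hᵢ b, x i)` with each `hᵢ ∈ H` and `x ∈ X`. -/
def InWreath {α ι : Type*} (H : Subgroup (Equiv.Perm α)) (X : Subgroup (Equiv.Perm ι))
    (g : Equiv.Perm (α × ι)) : Prop :=
  ∃ (h : ι → Equiv.Perm α) (x : Equiv.Perm ι),
    (∀ i, h i ∈ H) ∧ x ∈ X ∧ ∀ p : α × ι, g p = (h p.2 p.1, x p.2)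

/-- The projection of `G` to `Sym(ι)` (the group induced on the block system) equals `X`. -/
def ProjEq {α ι : Type*} (G : Subgroup (Equiv.Perm (α × ι)))
    (X : Subgroup (Equiv.Perm ι)) : Prop :=
  ∀ x : Equiv.Perm ι, x ∈ X ↔ ∃ g ∈ G, ∀ p : α × ι, (g p).2 = x p.2

/-- The component of `G` (the permutation group induced on the block `α × {i₀}` by its
setwise stabiliser in `G`) equals `H`. -/
def ComponentEq {α ι : Type*} (G : Subgroup (Equiv.Perm (α × ι))) (i₀ : ι)
    (H : Subgroup (Equiv.Perm α)) : Prop :=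
  ∀ σ : Equiv.Perm α, σ ∈ H ↔ ∃ g ∈ G, ∀ b : α, g (b, i₀) = (σ b, i₀)

/-- `N` is a normal subgroup of `K`, both regarded as subgroups of `Sym(α)`. -/
def NormalIn {α : Type*} (N K : Subgroup (Equiv.Perm α)) : Prop :=
  N ≤ K ∧ ∀ g ∈ K, ∀ x ∈ N, g * x * g⁻¹ ∈ N

/-- `T` is a minimal normal subgroup of `K`. -/
def IsMinimalNormalIn {α : Type*} (T K : Subgroup (Equiv.Perm α)) : Prop :=
  NormalIn T K ∧ T ≠ ⊥ ∧ ∀ N : Subgroup (Equiv.Perm α), NormalIn N K → N ≠ ⊥ → N ≤ T → N = T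

/-- `g` lies in the base group `T^n ≤ Sym(α × ι)`: it has the form `(b, i) ↦ (tᵢ b, i)`
with each `tᵢ ∈ T`. -/
def InBase {α ι : Type*} (T : Subgroup (Equiv.Perm α)) (g : Equiv.Perm (α × ι)) : Prop :=
  ∃ t : ι → Equiv.Perm α, (∀ i, t i ∈ T) ∧ ∀ p : α × ι, g p = (t p.2 p.1, p.2)

theorem Is2Trans.exists_apply_eq {α : Type*} {K : Subgroup (Equiv.Perm α)} (hK : Is2Trans K)
    (a b : α) : ∃ g ∈ K, g a = b := by
  obtain ⟨hα, h⟩ := hK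
  obtain ⟨a', ha'⟩ := exists_ne a
  obtain ⟨b', hb'⟩ := exists_ne b
  obtain ⟨g, hg, hab, -⟩ := h a a' b b' ha'.symm hb'.symm
  exact ⟨g, hg, hab⟩

/-- A nontrivial normal subgroup of a `2`-transitive group is transitive. -/
theorem Is2Trans.exists_apply_eq_of_normalIn {α : Type*} {N K : Subgroup (Equiv.Perm α)}
    (hK : Is2Trans K) (hN : NormalIn N K) (hne : N ≠ ⊥) (a b : α) : ∃ t ∈ N, t a = b := by
  rcases eq_or_ne a b with rfl | hab
  · exact ⟨1, N.one_mem, rfl⟩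
  obtain ⟨⟨t, ht⟩, ht1⟩ := Subgroup.ne_bot_iff_exists_ne_one.1 hne
  obtain ⟨c, hc⟩ : ∃ c, t c ≠ c := by
    by_contra! h
    exact ht1 (Subtype.ext (Equiv.ext h))
  obtain ⟨g, hg, hga, hgb⟩ := hK.2 c (t c) a b hc.symm hab
  refine ⟨g * t * g⁻¹, hN.2 g hg t ht, ?_⟩
  simp [← hga, ← hgb]

/-- The element `(b, i) ↦ (tᵢ b, i)` of the base group of `Sym(α) ≀ Sym(ι)`. -/
def basePerm {α ι : Type*} (t : ι → Equiv.Perm α) : Equiv.Perm (α × ι) where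
  toFun p := (t p.2 p.1, p.2)
  invFun p := ((t p.2).symm p.1, p.2)
  left_inv p := by simp
  right_inv p := by simp

/-- The number of orbits equals the size of a complete set of values of an orbit invariant. -/
theorem card_orbitRel_quotient_eq_of_invariant {M Y Z : Type*} [Group M] [MulAction M Y]
    (f : Y → Z) (hf : Function.Surjective f)
    (hinv : ∀ (g : M) (y : Y), f (g • y) = f y)
    (htrans : ∀ y z : Y, f y = f z → ∃ g : M, g • z = y) :
    Nat.card (MulAction.orbitRel.Quotient M Y) = Nat.card Z := by
  refine Nat.card_eq_of_bijective
    (Quotient.lift f (by rintro _ b ⟨g, rfl⟩; exact hinv g b)) ⟨?_, ?_⟩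
  · rintro ⟨y⟩ ⟨z⟩ h
    exact Quotient.sound (htrans y z h)
  · intro z
    obtain ⟨y, rfl⟩ := hf z
    exact ⟨Quotient.mk _ y, rfl⟩

open Classical in
/-- The relative position of two points of `α × ι`: equal (`0`), distinct in a common block (`1`),
or in different blocks (`2`). -/
noncomputable def relPosition {α ι : Type*} (p : (α × ι) × (α × ι)) : Fin 3 :=
  if p.1 = p.2 then 0 else if p.1.2 = p.2.2 then 1 else 2

theorem relPosition_surjective {α ι : Type*} [Nontrivial α] [Nontrivial ι] :
    Function.Surjective (relPosition (α := α) (ι := ι)) := by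
  obtain ⟨a, b, hab⟩ := exists_pair_ne α
  obtain ⟨i, j, hij⟩ := exists_pair_ne ι
  intro k
  fin_cases k
  · exact ⟨((a, i), (a, i)), by simp [relPosition]⟩
  · exact ⟨((a, i), (b, i)), by simp [relPosition, hab]⟩
  · exact ⟨((a, i), (a, j)), by simp [relPosition, hij]⟩

theorem InWreath.relPosition_eq {α ι : Type*} {H : Subgroup (Equiv.Perm α)}
    {X : Subgroup (Equiv.Perm ι)} {g : Equiv.Perm (α × ι)} (hg : InWreath H X g)
    (p q : α × ι) : relPosition (g p, g q) = relPosition (p, q) := by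
  obtain ⟨h, x, -, -, hgx⟩ := hg
  have hblock : (g p).2 = (g q).2 ↔ p.2 = q.2 := by simp [hgx]
  have hpoint : g p = g q ↔ p = q := g.injective.eq_iff
  unfold relPosition
  congr 1
  · exact propext hpoint
  · congr 1
    exact propext hblock

section

variable {α ι : Type*} {H T : Subgroup (Equiv.Perm α)} {X : Subgroup (Equiv.Perm ι)}
  {G : Subgroup (Equiv.Perm (α × ι))}

/-- `G` is transitive on pairs of distinct points lying in a common block. -/
theorem exists_apply_eq_of_same_block {i₀ : ι} (hH : Is2Trans H) (hX : Is2Trans X)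
    (hcomp : ComponentEq G i₀ H) (hproj : ProjEq G X) {p q r s : α × ι}
    (hpq : p ≠ q) (hpq' : p.2 = q.2) (hrs : r ≠ s) (hrs' : r.2 = s.2) :
    ∃ g ∈ G, g p = r ∧ g q = s := by
  have hmove : ∀ i : ι, ∃ g ∈ G, ∀ y : α × ι, y.2 = i → (g y).2 = i₀ := by
    intro i
    obtain ⟨x, hx, hxi⟩ := hX.exists_apply_eq i i₀
    obtain ⟨g, hg, hgx⟩ := (hproj x).1 hx
    exact ⟨g, hg, fun y hy => by rw [hgx, hy, hxi]⟩
  obtain ⟨g, hg, hgi⟩ := hmove q.2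
  obtain ⟨k, hk, hki⟩ := hmove s.2
  have hne : ∀ {u v : α × ι}, u ≠ v → u.2 = i₀ → v.2 = i₀ → u.1 ≠ v.1 :=
    fun huv hu hv h => huv (Prod.ext h (hu.trans hv.symm))
  obtain ⟨σ, hσ, hσ₁, hσ₂⟩ := hH.2 (g p).1 (g q).1 (k r).1 (k s).1
    (hne (g.injective.ne hpq) (hgi p hpq') (hgi q rfl))
    (hne (k.injective.ne hrs) (hki r hrs') (hki s rfl))
  obtain ⟨m, hm, hmσ⟩ := (hcomp σ).1 hσ
  have key : ∀ u v : α × ι, (g u).2 = i₀ → (k v).2 = i₀ → σ (g u).1 = (k v).1 →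
      (k⁻¹ * m * g) u = v := by
    intro u v hu hv h
    rw [Equiv.Perm.mul_apply, Equiv.Perm.mul_apply, Equiv.Perm.inv_eq_iff_eq,
      show g u = ((g u).1, i₀) from Prod.ext rfl hu, hmσ, h]
    exact Prod.ext rfl hv.symm
  exact ⟨k⁻¹ * m * g, G.mul_mem (G.mul_mem (G.inv_mem hk) hm) hg,
    key p r (hgi p hpq') (hki r hrs') hσ₁, key q s (hgi q rfl) (hki s rfl) hσ₂⟩

/-- `G` is transitive on pairs of points lying in different blocks. -/
theorem exists_apply_eq_of_ne_block (hX : Is2Trans X) (hT : ∀ a b : α, ∃ t ∈ T, t a = b)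
    (hproj : ProjEq G X) (hbase : ∀ g : Equiv.Perm (α × ι), InBase T g → g ∈ G)
    {p q r s : α × ι} (hpq : p.2 ≠ q.2) (hrs : r.2 ≠ s.2) :
    ∃ g ∈ G, g p = r ∧ g q = s := by
  classical
  obtain ⟨x, hx, hxp, hxq⟩ := hX.2 p.2 q.2 r.2 s.2 hpq hrs
  obtain ⟨g, hg, hgx⟩ := (hproj x).1 hx
  have hp : (g p).2 = r.2 := (hgx p).trans hxp
  have hq : (g q).2 = s.2 := (hgx q).trans hxq
  obtain ⟨t, ht, htp⟩ := hT (g p).1 r.1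
  obtain ⟨u, hu, huq⟩ := hT (g q).1 s.1
  refine ⟨basePerm (fun i => if i = r.2 then t else u) * g, G.mul_mem (hbase _
    ⟨fun i => if i = r.2 then t else u, fun i => ?_, fun _ => rfl⟩) hg, ?_, ?_⟩
  · dsimp only
    split_ifs <;> assumption
  · simp [basePerm, hp, htp]
  · simp [basePerm, hq, huq, hrs.symm]

end

/-- let `H ≤ Sym(B)` and `X ≤ Sₙ` both be 2-transitive and let `T` be a
minimal normal subgroup of `H`. If `G ≤ H ≀ X` has component `H`, projects onto `X`,
and contains the base subgroup `T^n`, then `G` has rank 3 on `B × {1,…,n}`. -/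
theorem stmt_2 {B : Type*} [Fintype B] {n : ℕ} (hn : 2 ≤ n)
    (H T : Subgroup (Equiv.Perm B)) (X : Subgroup (Equiv.Perm (Fin n)))
    (hH : Is2Trans H) (hX : Is2Trans X)
    (hT : IsMinimalNormalIn T H)
    (G : Subgroup (Equiv.Perm (B × Fin n)))
    (hGw : ∀ g ∈ G, InWreath H X g)
    (hcomp : ComponentEq G (⟨0, by omega⟩ : Fin n) H)
    (hproj : ProjEq G X)
    (hbase : ∀ g : Equiv.Perm (B × Fin n), InBase T g → g ∈ G) :
    Nat.card (MulAction.orbitRel.Quotient G ((B × Fin n) × (B × Fin n))) = 3 := by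
  have := hH.1
  have := hX.1
  have hTtrans := hH.exists_apply_eq_of_normalIn hT.1 hT.2.1
  rw [card_orbitRel_quotient_eq_of_invariant relPosition relPosition_surjective, Nat.card_fin]
  · rintro ⟨g, hg⟩ ⟨p, q⟩
    exact (hGw g hg).relPosition_eq p q
  · rintro ⟨p, q⟩ ⟨r, s⟩ h
    suffices ∃ g ∈ G, g r = p ∧ g s = q by
      obtain ⟨g, hg, hgr, hgs⟩ := this
      exact ⟨⟨g, hg⟩, Prod.ext hgr hgs⟩
    by_cases hpq : p = q <;> by_cases hrs : r = s <;>
      by_cases hpq' : p.2 = q.2 <;> by_cases hrs' : r.2 = s.2 <;>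
      simp only [relPosition, hpq, hrs, hpq', hrs', if_true, if_false] at h <;>
      first
      | exact absurd h (by decide)
      | exact absurd (congrArg Prod.snd hpq) hpq'
      | exact absurd (congrArg Prod.snd hrs) hrs'
      | exact exists_apply_eq_of_same_block hH hX hcomp hproj hrs hrs' hpq hpq'
      | exact exists_apply_eq_of_ne_block hX hTtrans hproj hbase hrs' hpq'
      | skip
    subst hpq hrs
    obtain ⟨x, hx, hxr⟩ := hX.exists_apply_eq r.2 p.2
    obtain ⟨g, hg, hgx⟩ := (hproj x).1 hx
    obtain ⟨t, ht, htr⟩ := hTtrans (g r).1 p.1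
    have hgr : (basePerm (fun _ : Fin n => t) * g : Equiv.Perm _) r = p :=
      Prod.ext htr ((hgx r).trans hxr)
    exact ⟨_, G.mul_mem (hbase _ ⟨fun _ => t, fun _ => ht, fun _ => rfl⟩) hg, hgr, hgr⟩
end

section
/- Let G be a transitive, imprimitive permutation group of rank 3 on a finite set Ω with nontrivial system of imprimitivity 𝓑, and suppose G is block-faithful, i.e., the kernel of the induced action of G on 𝓑 is trivial. Then G is almost simple: G has a unique minimal normal subgroup and this subgroup is nonabelian simple. -/
/-- A `G`-invariant partition of `Ω` (a system of imprimitivity, possibly trivial). -/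
def IsBlockSystem {Ω : Type*} (G : Subgroup (Equiv.Perm Ω)) (P : Set (Set Ω)) : Prop :=
  Setoid.IsPartition P ∧ ∀ g ∈ G, ∀ S ∈ P, (⇑g '' S) ∈ P

/-- A partition is nontrivial if it is neither the partition into singletons nor `{Ω}`. -/
def IsNontrivialSystem {Ω : Type*} (P : Set (Set Ω)) : Prop :=
  (∃ S ∈ P, ¬ S.Subsingleton) ∧ (∃ S ∈ P, S ≠ Set.univ)

/-- `N` is a minimal normal subgroup of `G`. -/
def IsMinimalNormal {G : Type*} [Group G] (N : Subgroup G) : Prop :=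
  N.Normal ∧ N ≠ ⊥ ∧ ∀ M : Subgroup G, M.Normal → M ≠ ⊥ → M ≤ N → M = N

section TwoTransitive

open MulAction

variable {G X : Type*} [Group G] [MulAction G X]

/-- In a faithful action, an element that commutes with a transitive set and fixes a point
is trivial. -/
theorem eq_one_of_commute_of_transitive [FaithfulSMul G X] {K : Subgroup G}
    (hK : ∀ x y : X, ∃ k ∈ K, k • x = y) {c : G} (hc : ∀ k ∈ K, k * c = c * k)
    {x : X} (hx : c • x = x) : c = 1 := by
  refine FaithfulSMul.eq_of_smul_eq_smul (α := X) fun y => ?_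
  obtain ⟨k, hk, rfl⟩ := hK x y
  rw [← mul_smul, ← hc k hk, mul_smul, hx, one_smul]

theorem exists_smul_ne_of_ne_one [FaithfulSMul G X] {g : G} (hg : g ≠ 1) :
    ∃ x : X, g • x ≠ x := by
  by_contra! h
  exact hg (FaithfulSMul.eq_of_smul_eq_smul (α := X) fun y => by rw [h, one_smul])

/-- Nontrivial normal subgroups of faithful 2-transitive groups are transitive. -/
theorem transitive_of_normal_of_two_transitive [FaithfulSMul G X]
    (h2 : ∀ a b c d : X, a ≠ b → c ≠ d → ∃ g : G, g • a = c ∧ g • b = d)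
    {N : Subgroup G} (hN : N.Normal) (hne : N ≠ ⊥) (x y : X) : ∃ n ∈ N, n • x = y := by
  by_cases hxy : x = y
  · exact ⟨1, N.one_mem, by rw [one_smul, hxy]⟩
  obtain ⟨n, hn, hn1⟩ := N.bot_or_exists_ne_one.resolve_left hne
  obtain ⟨a, ha⟩ := exists_smul_ne_of_ne_one (X := X) hn1
  obtain ⟨g, h1, h3⟩ := h2 a (n • a) x y ha.symm hxy
  refine ⟨g * n * g⁻¹, hN.conj_mem n hn g, ?_⟩
  rw [← h1, mul_smul, inv_smul_smul, mul_smul, h3]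

/-- The elements `g` for which the conjugate of `T` by `g` moves `b` to `c`. -/
def joiningConjugators (T : Subgroup G) (b c : X) : Set G :=
  {g | ∃ t ∈ T, (g * t * g⁻¹) • b = c}

theorem joiningConjugators_comm (T : Subgroup G) (b c : X) :
    joiningConjugators T b c = joiningConjugators T c b := by
  have key : ∀ b c : X, joiningConjugators T b c ⊆ joiningConjugators T c b := by
    rintro b c g ⟨t, ht, h⟩
    refine ⟨t⁻¹, T.inv_mem ht, ?_⟩
    rw [← conj_inv, ← h, inv_smul_smul]
  exact (key b c).antisymm (key c b)

theorem joiningConjugators_inter_subset (T : Subgroup G) (b c d : X) :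
    joiningConjugators T b c ∩ joiningConjugators T c d ⊆ joiningConjugators T b d := by
  rintro g ⟨⟨t, ht, h⟩, ⟨t', ht', h'⟩⟩
  refine ⟨t' * t, T.mul_mem ht' ht, ?_⟩
  rw [← conj_mul, mul_smul, h, h']

theorem ncard_joiningConjugators_smul [Finite G] (T : Subgroup G) (h : G) (b c : X) :
    (joiningConjugators T (h • b) (h • c)).ncard = (joiningConjugators T b c).ncard := by
  have : joiningConjugators T (h • b) (h • c) = (fun g => h * g) '' joiningConjugators T b c := by
    ext g
    simp only [joiningConjugators, Set.mem_image, Set.mem_ofPred_eq]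
    constructor
    · rintro ⟨t, ht, e⟩
      refine ⟨h⁻¹ * g, ⟨t, ht, ?_⟩, by group⟩
      rw [← smul_left_cancel_iff h, ← e, ← mul_smul, ← mul_smul]
      congr 1
      group
    · rintro ⟨g', ⟨t, ht, e⟩, rfl⟩
      refine ⟨t, ht, ?_⟩
      rw [← e, ← mul_smul, ← mul_smul]
      congr 1
      group
  rw [this, Set.ncard_image_of_injective _ (mul_right_injective h)]

theorem joiningConjugators_smul_of_mem {N T : Subgroup G} (hN : N.Normal)
    (hT : ∀ n ∈ N, ∀ t ∈ T, n * t * n⁻¹ ∈ T) {n : G} (hn : n ∈ N) (b c : X) :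
    joiningConjugators T (n • b) (n • c) = joiningConjugators T b c := by
  have key : ∀ n ∈ N, ∀ b c : X,
      joiningConjugators T b c ⊆ joiningConjugators T (n • b) (n • c) := by
    rintro n hn b c g ⟨t, ht, e⟩
    have hn' : g⁻¹ * n * g ∈ N := by simpa using hN.conj_mem n hn g⁻¹
    refine ⟨_, hT _ hn' t ht, ?_⟩
    rw [← e, ← mul_smul, ← mul_smul]
    congr 1
    group
  refine Set.Subset.antisymm ?_ (key n hn b c)
  simpa using key n⁻¹ (N.inv_mem hn) (n • b) (n • c)

/-- If a normal subgroup `N` of a 2-transitive group has a nontrivial intransitive subgroup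
normalised by `N`, then only the identity of `N` fixes two points. -/
theorem eq_one_of_fixes_two_of_intransitive [Finite G] [FaithfulSMul G X]
    (h2 : ∀ a b c d : X, a ≠ b → c ≠ d → ∃ g : G, g • a = c ∧ g • b = d)
    {N T : Subgroup G} (hN : N.Normal) (hT : ∀ n ∈ N, ∀ t ∈ T, n * t * n⁻¹ ∈ T)
    (hT1 : T ≠ ⊥) (hTint : ¬ ∀ x y : X, ∃ t ∈ T, t • x = y)
    {n : G} (hn : n ∈ N) {b c : X} (hbc : b ≠ c) (hb : n • b = b) (hc : n • c = c) : n = 1 := by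
  have hcard : ∀ {a b c d : X}, a ≠ b → c ≠ d →
      (joiningConjugators T a b).ncard = (joiningConjugators T c d).ncard := by
    intro a b c d hab hcd
    obtain ⟨g, rfl, rfl⟩ := h2 a b c d hab hcd
    rw [ncard_joiningConjugators_smul]
  have heq : ∀ {a b c d : X}, a ≠ b → c ≠ d →
      joiningConjugators T a b ⊆ joiningConjugators T c d →
      joiningConjugators T a b = joiningConjugators T c d := fun hab hcd hsub =>
    Set.eq_of_subset_of_ncard_le hsub (hcard hab hcd).ge (Set.toFinite _)
  have key : ∀ {b c d : X}, b ≠ c → d ≠ b → n • b = b → n • c = c →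
      joiningConjugators T b d ≠ joiningConjugators T b c → n • d = d := by
    intro b c d hbc hdb hb hc hI
    by_contra hd
    have hdc : c ≠ d := by rintro rfl; exact hI rfl
    have sub : ∀ {a : X}, n • a = a → a ≠ d →
        joiningConjugators T a d = joiningConjugators T d (n • d) := by
      intro a ha had
      refine heq had (Ne.symm hd) ?_
      refine Set.Subset.trans (Set.subset_inter ?_ ?_)
        (joiningConjugators_inter_subset T d a (n • d))
      · rw [joiningConjugators_comm]
      · conv_rhs => rw [← ha]
        rw [joiningConjugators_smul_of_mem hN hT hn]
    have h1 := sub hb hdb.symm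
    have h3 := sub hc hdc
    refine hI (heq hdb.symm hbc ?_)
    refine Set.Subset.trans (Set.subset_inter subset_rfl ?_)
      (joiningConjugators_inter_subset T b d c)
    rw [joiningConjugators_comm T d c, h1, h3]
  obtain ⟨t, ht, ht1⟩ := T.bot_or_exists_ne_one.resolve_left hT1
  obtain ⟨a, ha⟩ := exists_smul_ne_of_ne_one (X := X) ht1
  have hne : (joiningConjugators T b c).Nonempty := by
    rw [← Set.ncard_pos, hcard hbc ha.symm, Set.ncard_pos]
    exact ⟨1, t, ht, by simp⟩
  obtain ⟨g, hg⟩ := hne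
  obtain ⟨d, hdb, hd⟩ : ∃ d, d ≠ b ∧ joiningConjugators T b d ≠ joiningConjugators T b c := by
    by_contra! hall
    apply hTint
    have horb : ∀ d : X, ∃ t ∈ T, (g * t * g⁻¹) • b = d := by
      intro d
      by_cases hdb : d = b
      · exact ⟨1, T.one_mem, by simp [hdb]⟩
      · have : g ∈ joiningConjugators T b d := by rwa [hall d hdb]
        exact this
    have horb' : ∀ d : X, ∃ t ∈ T, t • (g⁻¹ • b) = d := by
      intro d
      obtain ⟨t, ht, e⟩ := horb (g • d)
      refine ⟨t, ht, ?_⟩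
      rw [← smul_left_cancel_iff g, ← e, mul_smul, mul_smul]
    intro x y
    obtain ⟨t, ht, rfl⟩ := horb' x
    obtain ⟨t', ht', rfl⟩ := horb' y
    exact ⟨t' * t⁻¹, T.mul_mem ht' (T.inv_mem ht), by rw [mul_smul, inv_smul_smul]⟩
  have hnd := key hbc hdb hb hc hd
  refine FaithfulSMul.eq_of_smul_eq_smul (α := X) fun e => ?_
  rw [one_smul]
  by_cases heb : e = b
  · rw [heb, hb]
  by_cases he : joiningConjugators T b e = joiningConjugators T b c
  · exact key hdb.symm heb hb hnd (he ▸ hd.symm)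
  · exact key hbc heb hb hc he

/-- A normal subgroup of a 2-transitive group which is a central product of two nontrivial
subgroups, one of them intransitive, is semiregular. -/
theorem semiregular_of_central_product_of_intransitive [Finite G] [FaithfulSMul G X]
    (h2 : ∀ a b c d : X, a ≠ b → c ≠ d → ∃ g : G, g • a = c ∧ g • b = d)
    {N T S : Subgroup G} (hN : N.Normal) (hT1 : T ≠ ⊥) (hS1 : S ≠ ⊥) (hTN : T ≤ N) (hSN : S ≤ N)
    (hcomm : ∀ t ∈ T, ∀ s ∈ S, t * s = s * t)
    (hprod : ∀ n ∈ N, ∃ t ∈ T, ∃ s ∈ S, n = t * s)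
    (hNtrans : ∀ x y : X, ∃ n ∈ N, n • x = y)
    (hTint : ¬ ∀ x y : X, ∃ t ∈ T, t • x = y)
    {n : G} (hn : n ∈ N) {b : X} (hb : n • b = b) : n = 1 := by
  have hT : ∀ n ∈ N, ∀ t ∈ T, n * t * n⁻¹ ∈ T := by
    intro n hn t ht
    obtain ⟨u, hu, s, hs, rfl⟩ := hprod n hn
    have : u * s * t * (u * s)⁻¹ = u * t * u⁻¹ := by
      rw [mul_assoc u s t, ← hcomm t ht s hs]
      group
    rw [this]
    exact T.mul_mem (T.mul_mem hu ht) (T.inv_mem hu)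
  by_contra hn1
  have fix : ∀ {m c : G}, m ∈ N → m ≠ 1 → m • b = b → c * m = m * c → c • b = b := by
    intro m c hm hm1 hmb hcm
    by_contra hcb
    refine hm1 (eq_one_of_fixes_two_of_intransitive h2 hN hT hT1 hTint hm
      (Ne.symm hcb) hmb ?_)
    rw [← mul_smul, ← hcm, mul_smul, hmb]
  have hTfix : ∀ t ∈ T, t • b = b := by
    intro t ht
    obtain ⟨u, hu, s, hs, rfl⟩ := hprod n hn
    have hub : u • b = b := fix hn hn1 hb (by rw [mul_assoc, ← hcomm u hu s hs])
    by_cases hu1 : u = 1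
    · subst hu1
      exact fix hn hn1 hb (by rw [one_mul, hcomm t ht s hs])
    · obtain ⟨c, hc, hc1⟩ := S.bot_or_exists_ne_one.resolve_left hS1
      have hcb : c • b = b := fix (hTN hu) hu1 hub (hcomm u hu c hc).symm
      exact fix (hSN hc) hc1 hcb (hcomm t ht c hc)
  refine hT1 (eq_bot_iff.2 fun t ht => ?_)
  rw [Subgroup.mem_bot]
  refine FaithfulSMul.eq_of_smul_eq_smul (α := X) fun x => ?_
  obtain ⟨m, hm, rfl⟩ := hNtrans b x
  have := hTfix _ (hT m⁻¹ (N.inv_mem hm) t ht)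
  rw [one_smul, ← smul_left_cancel_iff m⁻¹, ← mul_smul, inv_smul_smul, ← mul_smul]
  simpa using this

theorem card_eq_of_transitive_of_commute [FaithfulSMul G X] {T S : Subgroup G}
    (hcomm : ∀ t ∈ T, ∀ s ∈ S, t * s = s * t) (hT : ∀ x y : X, ∃ t ∈ T, t • x = y)
    (hS : ∀ x y : X, ∃ s ∈ S, s • x = y) (b : X) : Nat.card T = Nat.card X := by
  refine Nat.card_congr (Equiv.ofBijective (fun t : T => (t : G) • b) ⟨?_, ?_⟩)
  · intro t u htu
    have h : ((u : G)⁻¹ * (t : G)) • b = b := by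
      rw [mul_smul, inv_smul_eq_iff]
      exact htu
    have := eq_one_of_commute_of_transitive hS (c := ((u : G)⁻¹ * (t : G)))
      (fun s hs => (hcomm _ (T.mul_mem (T.inv_mem u.2) t.2) s hs).symm) h
    exact Subtype.ext (inv_mul_eq_one.1 this).symm
  · intro x
    obtain ⟨t, ht, rfl⟩ := hT b x
    exact ⟨⟨t, ht⟩, rfl⟩

/-- A normal subgroup of a 2-transitive group whose order divides the square of the degree is
semiregular. -/
theorem semiregular_of_card_dvd [Finite G] [Finite X] [FaithfulSMul G X]
    (h2 : ∀ a b c d : X, a ≠ b → c ≠ d → ∃ g : G, g • a = c ∧ g • b = d)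
    {N : Subgroup G} (hN : N.Normal) (hcard : Nat.card N ∣ Nat.card X * Nat.card X)
    {n : G} (hn : n ∈ N) {b : X} (hb : n • b = b) : n = 1 := by
  refine FaithfulSMul.eq_of_smul_eq_smul (α := X) fun y => ?_
  rw [one_smul]
  by_cases hyb : y = b
  · rw [hyb, hb]
  let K := stabilizer G b
  let H : Subgroup K := N.subgroupOf K
  let Y := SubMulAction.ofStabilizer G b
  have : H.Normal := hN.subgroupOf K
  have : IsPretransitive K Y := ⟨by
    rintro ⟨u, hu⟩ ⟨v, hv⟩
    obtain ⟨g, hg, hg'⟩ := h2 b u b v (Ne.symm hu) (Ne.symm hv)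
    exact ⟨⟨g, hg⟩, Subtype.ext hg'⟩⟩
  let y' : Y := ⟨y, hyb⟩
  have hd1 : (orbit H y').ncard ∣ Nat.card Y :=
    (IsBlock.orbit_of_normal y').ncard_dvd_card (nonempty_orbit y')
  have hY : Nat.card Y + 1 = Nat.card X := SubMulAction.nat_card_ofStabilizer_add_one_eq G b
  have hd2 : (orbit H y').ncard ∣ Nat.card X * Nat.card X := by
    refine Dvd.dvd.trans (b := Nat.card H) ?_ (Dvd.dvd.trans (b := Nat.card N) ?_ hcard)
    · rw [← Nat.card_coe_set_eq, ← Nat.card_congr (orbitProdStabilizerEquivGroup H y'),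
        Nat.card_prod]
      exact dvd_mul_right _ _
    · exact Subgroup.card_comap_dvd_of_injective N K.subtype K.subtype_injective
  have hcop : Nat.Coprime (Nat.card Y) (Nat.card X) := by simp [← hY]
  have h1 : (orbit H y').ncard = 1 :=
    Nat.eq_one_of_dvd_coprimes (hcop.mul_right hcop) hd1 hd2
  obtain ⟨z, hz⟩ := Set.ncard_eq_one.1 h1
  have hmem : y' = z := by
    have := mem_orbit_self (M := H) y'
    rwa [hz] at this
  have := mem_orbit y' (⟨⟨n, hb⟩, hn⟩ : H)
  rw [hz, ← hmem, Set.mem_singleton_iff] at this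
  exact congrArg Subtype.val this

/-- A normal subgroup of a 2-transitive group which is a central product of two nontrivial
subgroups is semiregular. -/
theorem semiregular_of_central_product [Finite G] [Finite X] [FaithfulSMul G X]
    (h2 : ∀ a b c d : X, a ≠ b → c ≠ d → ∃ g : G, g • a = c ∧ g • b = d)
    {N T S : Subgroup G} (hN : N.Normal) (hT1 : T ≠ ⊥) (hS1 : S ≠ ⊥) (hTN : T ≤ N) (hSN : S ≤ N)
    (hcomm : ∀ t ∈ T, ∀ s ∈ S, t * s = s * t)
    (hprod : ∀ n ∈ N, ∃ t ∈ T, ∃ s ∈ S, n = t * s)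
    {n : G} (hn : n ∈ N) {b : X} (hb : n • b = b) : n = 1 := by
  have hNtrans : ∀ x y : X, ∃ n ∈ N, n • x = y :=
    transitive_of_normal_of_two_transitive h2 hN (ne_bot_of_le_ne_bot hT1 hTN)
  by_cases hT : ∀ x y : X, ∃ t ∈ T, t • x = y
  swap
  · exact semiregular_of_central_product_of_intransitive h2 hN hT1 hS1 hTN hSN hcomm hprod
      hNtrans hT hn hb
  have hcomm' : ∀ s ∈ S, ∀ t ∈ T, s * t = t * s := fun s hs t ht => (hcomm t ht s hs).symm
  by_cases hS : ∀ x y : X, ∃ s ∈ S, s • x = y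
  swap
  · refine semiregular_of_central_product_of_intransitive h2 hN hS1 hT1 hSN hTN hcomm' ?_
      hNtrans hS hn hb
    intro n hn
    obtain ⟨t, ht, s, hs, rfl⟩ := hprod n hn
    exact ⟨s, hs, t, ht, hcomm t ht s hs⟩
  refine semiregular_of_card_dvd h2 hN ?_ hn hb
  rw [← card_eq_of_transitive_of_commute hcomm hT hS b]
  nth_rw 2 [card_eq_of_transitive_of_commute hcomm hT hS b]
  rw [← card_eq_of_transitive_of_commute hcomm' hS hT b, ← Nat.card_prod]
  let f : T × S →* N := MonoidHom.noncommCoprod (Subgroup.inclusion hTN) (Subgroup.inclusion hSN)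
    fun t s => Subtype.ext (hcomm t t.2 s s.2)
  refine Subgroup.card_dvd_of_surjective f ?_
  rintro ⟨n, hn⟩
  obtain ⟨t, ht, s, hs, rfl⟩ := hprod n hn
  exact ⟨(⟨t, ht⟩, ⟨s, hs⟩), rfl⟩

end TwoTransitive

section Groups

variable {G : Type*} [Group G]

theorem exists_isMinimalNormal [Finite G] [Nontrivial G] : ∃ N : Subgroup G, IsMinimalNormal N := by
  obtain ⟨N, hN⟩ := (Set.toFinite {N : Subgroup G | N.Normal ∧ N ≠ ⊥}).exists_minimal
    ⟨⊤, inferInstance, top_ne_bot⟩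
  exact ⟨N, hN.prop.1, hN.prop.2, fun M h1 h3 h4 => h4.antisymm (hN.le_of_le ⟨h1, h3⟩ h4)⟩

/-- A minimal normal subgroup that is not simple is a central product of two nontrivial
subgroups. -/
theorem IsMinimalNormal.exists_central_product [Finite G] {N : Subgroup G}
    (hN : IsMinimalNormal N) (hsimple : ¬ IsSimpleGroup N) :
    ∃ T S : Subgroup G, T ≠ ⊥ ∧ S ≠ ⊥ ∧ T ≤ N ∧ S ≤ N ∧
      (∀ t ∈ T, ∀ s ∈ S, t * s = s * t) ∧ ∀ n ∈ N, ∃ t ∈ T, ∃ s ∈ S, n = t * s := by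
  have : Nontrivial N := (Subgroup.nontrivial_iff_ne_bot N).2 hN.2.1
  obtain ⟨H, hH, hHbot, hHtop⟩ : ∃ H : Subgroup N, H.Normal ∧ H ≠ ⊥ ∧ H ≠ ⊤ := by
    by_contra! h
    exact hsimple ⟨fun H hH => or_iff_not_imp_left.2 (h H hH)⟩
  let F : Set (Subgroup G) :=
    {T | T ≠ ⊥ ∧ T < N ∧ ∀ n ∈ N, ∀ t ∈ T, n * t * n⁻¹ ∈ T}
  have hF : H.map N.subtype ∈ F := by
    refine ⟨?_, ?_, ?_⟩
    · rwa [Ne, Subgroup.map_eq_bot_iff_of_injective _ N.subtype_injective]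
    · refine lt_of_le_of_ne (Subgroup.map_subtype_le H) fun h => hHtop ?_
      refine Subgroup.map_injective N.subtype_injective ?_
      rw [h, ← MonoidHom.range_eq_map, Subgroup.range_subtype]
    · rintro n hn _ ⟨t, ht, rfl⟩
      exact ⟨⟨n, hn⟩ * t * ⟨n, hn⟩⁻¹, hH.conj_mem t ht _, rfl⟩
  obtain ⟨T, hTmin⟩ := (Set.toFinite F).exists_minimal ⟨_, hF⟩
  obtain ⟨hT1, hTN, hTnorm⟩ := hTmin.prop
  let S : Subgroup G := Subgroup.centralizer T ⊓ N
  have hcomm : ∀ t ∈ T, ∀ s ∈ S, t * s = s * t := fun t ht s hs =>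
    Subgroup.mem_centralizer_iff.1 hs.1 t ht
  have hprod : ∀ n ∈ N, ∃ t ∈ T, ∃ s ∈ S, n = t * s := by
    let f : T × S →* G := MonoidHom.noncommCoprod T.subtype S.subtype
      fun t s => hcomm t t.2 s s.2
    suffices hle : N ≤ f.range by
      intro n hn
      obtain ⟨⟨t, s⟩, rfl⟩ := hle hn
      exact ⟨t, t.2, s, s.2, rfl⟩
    have hcl : Subgroup.normalClosure (T : Set G) = N := by
      refine hN.2.2 _ Subgroup.normalClosure_normal ?_ ?_
      · exact ne_bot_of_le_ne_bot hT1 Subgroup.le_normalClosure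
      · have := hN.1
        exact Subgroup.normalClosure_le_normal hTN.le
    rw [← hcl, Subgroup.normalClosure, Subgroup.closure_le]
    intro x hx
    obtain ⟨t, ht, hconj⟩ := Group.mem_conjugatesOfSet_iff.1 hx
    obtain ⟨g, rfl⟩ := isConj_iff.1 hconj
    let T' : Subgroup G := T.map (MulAut.conj g).toMonoidHom
    have hT'norm : ∀ n ∈ N, ∀ u ∈ T', n * u * n⁻¹ ∈ T' := by
      rintro n hn _ ⟨u, hu, rfl⟩
      have hn' : g⁻¹ * n * g ∈ N := by simpa using hN.1.conj_mem n hn g⁻¹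
      refine ⟨_, hTnorm _ hn' u hu, ?_⟩
      simp [mul_assoc]
    have hT'N : T' ≤ N := by
      rintro _ ⟨u, hu, rfl⟩
      exact hN.1.conj_mem u (hTN.le hu) g
    have hxT' : g * t * g⁻¹ ∈ T' := ⟨t, ht, rfl⟩
    by_cases hinter : T ⊓ T' = ⊥
    · refine ⟨(1, ⟨g * t * g⁻¹, ?_, hT'N hxT'⟩), one_mul _⟩
      refine Subgroup.mem_centralizer_iff.2 fun u hu => ?_
      have hmem : u * (g * t * g⁻¹) * u⁻¹ * (g * t * g⁻¹)⁻¹ ∈ T ⊓ T' := by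
        refine ⟨?_, T'.mul_mem (hT'norm u (hTN.le hu) _ hxT') (T'.inv_mem hxT')⟩
        have := T.mul_mem hu (hTnorm _ (hT'N hxT') _ (T.inv_mem hu))
        rw [show u * (g * t * g⁻¹) * u⁻¹ * (g * t * g⁻¹)⁻¹ =
          u * (g * t * g⁻¹ * u⁻¹ * (g * t * g⁻¹)⁻¹) by simp only [mul_assoc]]
        exact this
      rw [hinter, Subgroup.mem_bot] at hmem
      exact mul_inv_eq_iff_eq_mul.1 (mul_inv_eq_one.1 hmem)
    · have hle : T ≤ T ⊓ T' := by
        refine hTmin.le_of_le ⟨hinter, inf_le_left.trans_lt hTN, ?_⟩ inf_le_left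
        exact fun n hn u hu => ⟨hTnorm n hn u hu.1, hT'norm n hn u hu.2⟩
      have heq : T = T' := by
        refine Subgroup.eq_of_le_of_card_ge (hle.trans inf_le_right) (le_of_eq ?_)
        exact Subgroup.card_map_of_injective (MulAut.conj g).injective
      refine ⟨(⟨g * t * g⁻¹, ?_⟩, 1), mul_one _⟩
      rw [heq]
      exact hxT'
  refine ⟨T, S, hT1, fun hS => hTN.not_ge fun n hn => ?_, hTN.le, inf_le_right, hcomm, hprod⟩
  obtain ⟨t, ht, s, hs, rfl⟩ := hprod n hn
  rw [hS, Subgroup.mem_bot] at hs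
  rwa [hs, mul_one]

/-- A finite faithful 2-transitive group without semiregular nontrivial normal subgroups is
almost simple. -/
theorem almostSimple_of_two_transitive {X : Type*} [MulAction G X] [Finite G] [Finite X]
    [Nontrivial X] [FaithfulSMul G X]
    (h2 : ∀ a b c d : X, a ≠ b → c ≠ d → ∃ g : G, g • a = c ∧ g • b = d)
    (hreg : ∀ N : Subgroup G, N.Normal → N ≠ ⊥ → ∃ n ∈ N, n ≠ 1 ∧ ∃ x : X, n • x = x) :
    ∃ N : Subgroup G, IsMinimalNormal N ∧ IsSimpleGroup N ∧
      (∃ x y : N, x * y ≠ y * x) ∧ ∀ M : Subgroup G, IsMinimalNormal M → M = N := by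
  have : Nontrivial G := by
    obtain ⟨a, b, hab⟩ := exists_pair_ne X
    obtain ⟨g, hg, -⟩ := h2 a b b a hab hab.symm
    exact ⟨g, 1, by rintro rfl; exact hab (by rwa [one_smul] at hg)⟩
  obtain ⟨N, hN⟩ := exists_isMinimalNormal (G := G)
  have hcent : Subgroup.centralizer (N : Set G) = ⊥ := by
    by_contra hne
    have := hN.1
    obtain ⟨c, hc, hc1, x, hx⟩ := hreg _ Subgroup.normal_centralizer hne
    exact hc1 (eq_one_of_commute_of_transitive
      (transitive_of_normal_of_two_transitive h2 hN.1 hN.2.1)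
      (Subgroup.mem_centralizer_iff.1 hc) hx)
  refine ⟨N, hN, ?_, ?_, ?_⟩
  · by_contra hsimple
    obtain ⟨T, S, hT1, hS1, hTN, hSN, hcomm, hprod⟩ := hN.exists_central_product hsimple
    obtain ⟨n, hn, hn1, x, hx⟩ := hreg N hN.1 hN.2.1
    exact hn1 (semiregular_of_central_product h2 hN.1 hT1 hS1 hTN hSN hcomm hprod hn hx)
  · by_contra! hab
    refine hN.2.1 (eq_bot_iff.2 fun n hn => ?_)
    rw [← hcent, Subgroup.mem_centralizer_iff]
    exact fun m hm => congrArg Subtype.val (hab ⟨m, hm⟩ ⟨n, hn⟩)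
  · intro M hM
    by_contra hMN
    have hMn := hM.1
    have hNn := hN.1
    have hbot : M ⊓ N = ⊥ := by
      by_contra hne
      have h1 := hM.2.2 (M ⊓ N) inferInstance hne inf_le_left
      have h3 := hN.2.2 (M ⊓ N) inferInstance hne inf_le_right
      exact hMN (h1.symm.trans h3)
    refine hM.2.1 (eq_bot_iff.2 fun m hm => ?_)
    rw [← hcent, Subgroup.mem_centralizer_iff]
    exact fun n hn => (Subgroup.commute_of_normal_of_disjoint M N hMn hNn
      (disjoint_iff.2 hbot) m n hm hn).symm

end Groups

/-- The action of a permutation group on the blocks of an invariant partition. -/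
abbrev IsBlockSystem.mulAction {Ω : Type*} {G : Subgroup (Equiv.Perm Ω)}
    {P : Set (Set Ω)} (h : IsBlockSystem G P) : MulAction G P where
  smul g S := ⟨⇑(g : Equiv.Perm Ω) '' S, h.2 g g.2 S S.2⟩
  one_smul _ := Subtype.ext (Set.image_id _)
  mul_smul g k S := Subtype.ext (Set.image_comp g.1 k.1 S.1)

/-- In a group of rank 3, the pairs outside an invariant reflexive relation which is neither
equality nor universal form a single orbit. -/
theorem exists_smul_eq_of_rank_three {G Ω : Type*} [Group G] [MulAction G Ω]
    (hrank3 : Nat.card (MulAction.orbitRel.Quotient G (Ω × Ω)) = 3)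
    {R : Ω → Ω → Prop} (hR : ∀ (g : G) x y, R x y → R (g • x) (g • y)) (hrefl : ∀ x, R x x)
    {a b c : Ω} (hab : a ≠ b) (hRab : R a b) (hRac : ¬ R a c) {p q : Ω} (hpq : ¬ R p q) :
    ∃ g : G, g • a = p ∧ g • c = q := by
  have hfin : Finite (MulAction.orbitRel.Quotient G (Ω × Ω)) :=
    Nat.finite_of_card_ne_zero (by omega)
  have hrel : ∀ {x y u v : Ω},
      (⟦(u, v)⟧ : MulAction.orbitRel.Quotient G (Ω × Ω)) = ⟦(x, y)⟧ →
        ∃ g : G, g • x = u ∧ g • y = v := by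
    intro x y u v e
    obtain ⟨g, hg⟩ := MulAction.orbitRel_apply.1 (Quotient.exact e)
    exact ⟨g, congrArg Prod.fst hg, congrArg Prod.snd hg⟩
  have hRiff : ∀ {x y u v : Ω},
      (⟦(u, v)⟧ : MulAction.orbitRel.Quotient G (Ω × Ω)) = ⟦(x, y)⟧ → R x y → R u v := by
    intro x y u v e h
    obtain ⟨g, rfl, rfl⟩ := hrel e
    exact hR g x y h
  have hdiag : (⟦(a, b)⟧ : MulAction.orbitRel.Quotient G (Ω × Ω)) ≠ ⟦(a, a)⟧ := fun e => by
    obtain ⟨g, h1, h3⟩ := hrel e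
    exact hab (h1.symm.trans h3)
  let f : Fin 3 → MulAction.orbitRel.Quotient G (Ω × Ω) := ![⟦(a, a)⟧, ⟦(a, b)⟧, ⟦(a, c)⟧]
  have hinj : Function.Injective f := by
    intro i j hij
    fin_cases i <;> fin_cases j <;>
      first
        | rfl
        | exact absurd hij hdiag
        | exact absurd hij.symm hdiag
        | exact absurd (hRiff hij (hrefl a)) hRac
        | exact absurd (hRiff hij.symm (hrefl a)) hRac
        | exact absurd (hRiff hij hRab) hRac
        | exact absurd (hRiff hij.symm hRab) hRac
  have hbij : Function.Bijective f := (Nat.bijective_iff_injective_and_card f).2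
    ⟨hinj, by rw [hrank3, Nat.card_eq_fintype_card, Fintype.card_fin]⟩
  obtain ⟨i, hi⟩ := hbij.2 ⟦(p, q)⟧
  fin_cases i
  · exact absurd (hRiff hi.symm (hrefl a)) hpq
  · exact absurd (hRiff hi.symm hRab) hpq
  · exact hrel hi.symm

/-- a transitive, imprimitive, block-faithful permutation group of rank 3
on a finite set is almost simple: it has a unique minimal normal subgroup, and this
subgroup is nonabelian simple. -/
theorem stmt_4 {Ω : Type*} [Fintype Ω] (G : Subgroup (Equiv.Perm Ω))
    (P : Set (Set Ω))
    (htrans : ∀ p q : Ω, ∃ g ∈ G, g p = q)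
    (hrank3 : Nat.card (MulAction.orbitRel.Quotient G (Ω × Ω)) = 3)
    (hblocks : IsBlockSystem G P) (hnontriv : IsNontrivialSystem P)
    (hfaithful : ∀ g ∈ G, (∀ S ∈ P, ⇑g '' S = S) → g = 1) :
    ∃ N : Subgroup G, IsMinimalNormal N ∧ IsSimpleGroup N ∧
      (∃ x y : N, x * y ≠ y * x) ∧
      ∀ M : Subgroup G, IsMinimalNormal M → M = N := by
  obtain ⟨⟨hempty, hcover⟩, hinv⟩ := id hblocks
  obtain ⟨⟨S₀, hS₀, hS₀two⟩, S₁, hS₁, hS₁univ⟩ := hnontriv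
  have huniq : ∀ {x : Ω} {S T : Set Ω}, S ∈ P → T ∈ P → x ∈ S → x ∈ T → S = T :=
    fun {x S T} hS hT hxS hxT => (hcover x).unique ⟨hS, hxS⟩ ⟨hT, hxT⟩
  have hnonempty : ∀ S ∈ P, S.Nonempty := fun S hS =>
    Set.nonempty_iff_ne_empty.2 fun h => hempty (h ▸ hS)
  let R : Ω → Ω → Prop := fun x y => ∃ S ∈ P, x ∈ S ∧ y ∈ S
  have hR : ∀ (g : G) x y, R x y → R (g • x) (g • y) := fun g x y ⟨S, hS, hx, hy⟩ =>
    ⟨_, hinv g g.2 S hS, Set.mem_image_of_mem _ hx, Set.mem_image_of_mem _ hy⟩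
  have hrefl : ∀ x, R x x := fun x => by
    obtain ⟨S, ⟨hS, hx⟩, -⟩ := hcover x
    exact ⟨S, hS, hx, hx⟩
  have hRmem : ∀ {x y : Ω} {S : Set Ω}, S ∈ P → x ∈ S → R x y → y ∈ S :=
    fun hS hx ⟨T, hT, hxT, hyT⟩ => huniq hT hS hxT hx ▸ hyT
  obtain ⟨a, ha, b, hb, hab⟩ := Set.not_subsingleton_iff.1 hS₀two
  obtain ⟨c, hc⟩ : ∃ c, c ∉ S₀ := by
    by_contra! h
    obtain ⟨x, hx⟩ := hnonempty S₁ hS₁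
    exact hS₁univ (huniq hS₁ hS₀ hx (h x) ▸ Set.eq_univ_of_forall h)
  have hRac : ¬ R a c := fun h => hc (hRmem hS₀ ha h)
  have hcross : ∀ {p q r s : Ω}, ¬ R p q → ¬ R r s → ∃ g : G, g • p = r ∧ g • q = s := by
    intro p q r s hpq hrs
    obtain ⟨g, rfl, rfl⟩ :=
      exists_smul_eq_of_rank_three hrank3 hR hrefl hab ⟨S₀, hS₀, ha, hb⟩ hRac hpq
    obtain ⟨k, rfl, rfl⟩ :=
      exists_smul_eq_of_rank_three hrank3 hR hrefl hab ⟨S₀, hS₀, ha, hb⟩ hRac hrs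
    exact ⟨k * g⁻¹, by rw [mul_smul, inv_smul_smul], by rw [mul_smul, inv_smul_smul]⟩
  let _ := hblocks.mulAction
  have hsmul : ∀ (g : G) {S T : P} {x : Ω}, x ∈ S.1 → g • x ∈ T.1 → g • S = T :=
    fun g S T x hx hgx => Subtype.ext <|
      huniq (hinv g g.2 S S.2) T.2 (Set.mem_image_of_mem _ hx) hgx
  have : FaithfulSMul G P := ⟨by
    intro g k h
    have : k⁻¹ * g = 1 := Subtype.ext <| hfaithful _ (k⁻¹ * g).2 fun S hS =>
      congrArg Subtype.val (show (k⁻¹ * g) • (⟨S, hS⟩ : P) = ⟨S, hS⟩ by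
        rw [mul_smul, h, inv_smul_smul])
    exact (inv_mul_eq_one.1 this).symm⟩
  have : Nontrivial P := by
    obtain ⟨T, ⟨hT, hcT⟩, -⟩ := hcover c
    refine ⟨⟨S₀, hS₀⟩, ⟨T, hT⟩, fun h => hc ?_⟩
    rwa [show S₀ = T from congrArg Subtype.val h]
  refine almostSimple_of_two_transitive (X := P) ?_ ?_
  · intro A B C D hAB hCD
    obtain ⟨p, hp⟩ := hnonempty A A.2
    obtain ⟨q, hq⟩ := hnonempty B B.2
    obtain ⟨r, hr⟩ := hnonempty C C.2
    obtain ⟨s, hs⟩ := hnonempty D D.2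
    obtain ⟨g, rfl, rfl⟩ := hcross
      (fun h => hAB (Subtype.ext (huniq A.2 B.2 (hRmem A.2 hp h) hq)))
      (fun h => hCD (Subtype.ext (huniq C.2 D.2 (hRmem C.2 hr h) hs)))
    exact ⟨g, hsmul g hp hr, hsmul g hq hs⟩
  · intro N hN hne
    obtain ⟨n, hn, hn1⟩ := N.bot_or_exists_ne_one.resolve_left hne
    obtain ⟨S, hS⟩ := exists_smul_ne_of_ne_one (X := P) hn1
    obtain ⟨p, hp⟩ := hnonempty S S.2
    have hpn : ¬ R p (n • p) := fun h => hS (hsmul n hp (hRmem S.2 hp h))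
    have hNcross : ∀ {q r : Ω}, ¬ R q r → ∃ m ∈ N, m • q = r := by
      intro q r hqr
      obtain ⟨g, rfl, rfl⟩ := hcross hpn hqr
      exact ⟨g * n * g⁻¹, hN.conj_mem n hn g, by rw [mul_smul, inv_smul_smul, mul_smul]⟩
    obtain ⟨m, hm, hmc⟩ := hNcross hRac
    obtain ⟨k, hk, hkb⟩ := hNcross (q := c) (r := b)
      fun ⟨T, hT, hcT, hbT⟩ => hc (huniq hT hS₀ hbT hb ▸ hcT)
    have hkm : (k * m) • a = b := by rw [mul_smul, hmc, hkb]
    refine ⟨k * m, N.mul_mem hk hm, fun h => hab ?_, ⟨S₀, hS₀⟩, hsmul _ ha (hkm ▸ hb)⟩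
    rw [← hkm, h, one_smul]
end

section
/- Let G be a transitive, imprimitive permutation group of rank 3 acting on a finite set Ω, with nontrivial system of imprimitivity 𝓑 (which is unique). Then G is block-faithful with respect to 𝓑 if and only if G is quasiprimitive on Ω. -/
/-- Two points lie in a common part of `P`. -/
def SamePart {Ω : Type*} (P : Set (Set Ω)) (x y : Ω) : Prop :=
  ∃ S ∈ P, x ∈ S ∧ y ∈ S

lemma Setoid.IsPartition.eq_of_mem_mem {Ω : Type*} {P : Set (Set Ω)}
    (hP : Setoid.IsPartition P) {S T : Set Ω} (hS : S ∈ P) (hT : T ∈ P) {x : Ω}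
    (hxS : x ∈ S) (hxT : x ∈ T) : S = T :=
  (hP.2 x).unique ⟨hS, hxS⟩ ⟨hT, hxT⟩

lemma IsBlockSystem.samePart_apply {Ω : Type*} {G : Subgroup (Equiv.Perm Ω)} {P : Set (Set Ω)}
    (h : IsBlockSystem G P) {g : Equiv.Perm Ω} (hg : g ∈ G) {x y : Ω} (hxy : SamePart P x y) :
    SamePart P (g x) (g y) := by
  obtain ⟨S, hS, hx, hy⟩ := hxy
  exact ⟨_, h.2 g hg S hS, Set.mem_image_of_mem _ hx, Set.mem_image_of_mem _ hy⟩

lemma eq_of_natCard_eq_three {α : Type*} (h : Nat.card α = 3) {a b c d : α}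
    (hab : a ≠ b) (hac : a ≠ c) (hbc : b ≠ c) (had : a ≠ d) (hbd : b ≠ d) : c = d := by
  classical
  by_contra hcd
  have : Finite α := Nat.finite_of_card_ne_zero (by omega)
  have := Fintype.ofFinite α
  have hle := Finset.card_le_univ ({a, b, c, d} : Finset α)
  rw [← Nat.card_eq_fintype_card, h] at hle
  simp [*] at hle

/-- In a rank 3 group, any two pairs of points in different blocks of a nontrivial system of
imprimitivity are conjugate. -/
lemma IsBlockSystem.exists_apply_eq_of_not_samePart {Ω : Type*} {G : Subgroup (Equiv.Perm Ω)}
    {P : Set (Set Ω)} (hrank3 : Nat.card (MulAction.orbitRel.Quotient G (Ω × Ω)) = 3)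
    (hblocks : IsBlockSystem G P) (hnontriv : ∃ S ∈ P, ¬ S.Subsingleton) {x y p q : Ω}
    (hxy : ¬ SamePart P x y) (hpq : ¬ SamePart P p q) :
    ∃ g ∈ G, g x = p ∧ g y = q := by
  obtain ⟨S, hS, hns⟩ := hnontriv
  obtain ⟨a, ha, b, hb, hab⟩ := Set.not_subsingleton_iff.mp hns
  let cls : Ω × Ω → MulAction.orbitRel.Quotient G (Ω × Ω) := Quotient.mk''
  have hcls {u v : Ω × Ω} (h : cls u = cls v) : ∃ g ∈ G, g v.1 = u.1 ∧ g v.2 = u.2 := by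
    obtain ⟨g, hg⟩ := MulAction.orbitRel_apply.mp (Quotient.eq''.mp h)
    exact ⟨g, g.2, congrArg Prod.fst hg, congrArg Prod.snd hg⟩
  have hne {u v : Ω × Ω} (hu : ¬ SamePart P u.1 u.2) (hv : SamePart P v.1 v.2) :
      cls v ≠ cls u := fun h => by
    obtain ⟨g, hg, h₁, h₂⟩ := hcls h.symm
    exact hu (h₁ ▸ h₂ ▸ hblocks.samePart_apply hg hv)
  have hdiag : cls (a, b) ≠ cls (a, a) := fun h => by
    obtain ⟨g, -, h₁, h₂⟩ := hcls h
    exact hab (h₁.symm.trans h₂)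
  have haa : SamePart P a a := ⟨S, hS, ha, ha⟩
  have hsab : SamePart P a b := ⟨S, hS, ha, hb⟩
  exact hcls (u := (p, q)) (v := (x, y)) <| eq_of_natCard_eq_three hrank3 hdiag
    (hne hpq hsab) (hne hpq haa) (hne hxy hsab) (hne hxy haa)

/-- A permutation that moves some part of an invariant partition moves some point to a
different part. -/
lemma IsBlockSystem.exists_not_samePart_apply {Ω : Type*} {G : Subgroup (Equiv.Perm Ω)}
    {P : Set (Set Ω)} (hblocks : IsBlockSystem G P) {g : Equiv.Perm Ω} (hg : g ∈ G)
    {S : Set Ω} (hS : S ∈ P) (hgS : ⇑g '' S ≠ S) : ∃ s, ¬ SamePart P s (g s) := by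
  obtain ⟨s, hs⟩ := Setoid.nonempty_of_mem_partition hblocks.1 hS
  refine ⟨s, fun ⟨T, hT, hsT, hgT⟩ => hgS ?_⟩
  rw [hblocks.1.eq_of_mem_mem (hblocks.2 g hg S hS) hT (Set.mem_image_of_mem _ hs) hgT,
    hblocks.1.eq_of_mem_mem hS hT hs hsT]

/-- The kernel of the action of `G` on the parts of `P`. -/
def partsKernel {Ω : Type*} (G : Subgroup (Equiv.Perm Ω)) (P : Set (Set Ω)) : Subgroup G where
  carrier := {g | ∀ S ∈ P, ⇑(g : Equiv.Perm Ω) '' S = S}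
  one_mem' := fun S _ => by simp
  mul_mem' := fun {a b} ha hb S hS => by
    rw [Subgroup.coe_mul, Equiv.Perm.coe_mul, Set.image_comp, hb S hS, ha S hS]
  inv_mem' := fun {a} ha S hS => by
    conv_lhs => rw [← ha S hS]
    rw [← Set.image_comp, ← Equiv.Perm.coe_mul, ← Subgroup.coe_mul]
    simp

lemma IsBlockSystem.normal_partsKernel {Ω : Type*} {G : Subgroup (Equiv.Perm Ω)}
    {P : Set (Set Ω)} (hblocks : IsBlockSystem G P) : (partsKernel G P).Normal where
  conj_mem n hn g S hS := by
    have h := hn _ (hblocks.2 _ (g⁻¹).2 S hS)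
    rw [Subgroup.coe_mul, Subgroup.coe_mul, Equiv.Perm.coe_mul, Equiv.Perm.coe_mul,
      Set.image_comp, Set.image_comp, h, ← Set.image_comp, ← Equiv.Perm.coe_mul,
      ← Subgroup.coe_mul]
    simp

/-- a transitive, imprimitive permutation group of rank 3 on a finite set,
with nontrivial system of imprimitivity `P`, is block-faithful with respect to `P` if
and only if it is quasiprimitive (every nontrivial normal subgroup is transitive). -/
theorem stmt_5 {Ω : Type*} [Fintype Ω] (G : Subgroup (Equiv.Perm Ω))
    (P : Set (Set Ω))
    (htrans : ∀ p q : Ω, ∃ g ∈ G, g p = q)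
    (hrank3 : Nat.card (MulAction.orbitRel.Quotient G (Ω × Ω)) = 3)
    (hblocks : IsBlockSystem G P) (hnontriv : IsNontrivialSystem P) :
    (∀ g ∈ G, (∀ S ∈ P, ⇑g '' S = S) → g = 1) ↔
      (∀ N : Subgroup G, N.Normal → N ≠ ⊥ →
        ∀ p q : Ω, ∃ x : G, x ∈ N ∧ (x : Equiv.Perm Ω) p = q) := by
  constructor
  · intro hfaith N hN hbot
    obtain ⟨n, hn, hn1⟩ := N.bot_or_exists_ne_one.resolve_left hbot
    obtain ⟨S, hS, hnS⟩ : ∃ S ∈ P, ⇑(n : Equiv.Perm Ω) '' S ≠ S := by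
      by_contra! h
      exact hn1 (Subtype.ext (hfaith _ n.2 h))
    obtain ⟨s, hs⟩ := hblocks.exists_not_samePart_apply n.2 hS hnS
    have hdiff (p q : Ω) (hpq : ¬ SamePart P p q) :
        ∃ x : G, x ∈ N ∧ (x : Equiv.Perm Ω) p = q := by
      obtain ⟨g, hg, rfl, rfl⟩ :=
        hblocks.exists_apply_eq_of_not_samePart hrank3 hnontriv.1 hs hpq
      exact ⟨_, hN.conj_mem _ hn ⟨g, hg⟩, by simp⟩
    intro p q
    by_cases hpq : SamePart P p q
    · obtain ⟨T, hT, hp, hq⟩ := hpq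
      obtain ⟨r, hr⟩ : ∃ r, r ∉ T := by
        by_contra! h
        obtain ⟨U, hU, hne⟩ := hnontriv.2
        obtain ⟨u, hu⟩ := Setoid.nonempty_of_mem_partition hblocks.1 hU
        exact hne (hblocks.1.eq_of_mem_mem hU hT hu (h u) ▸ Set.eq_univ_of_forall h)
      obtain ⟨x, hx, hxp⟩ := hdiff p r fun ⟨U, hU, hpU, hrU⟩ =>
        hr (hblocks.1.eq_of_mem_mem hU hT hpU hp ▸ hrU)
      obtain ⟨y, hy, hyr⟩ := hdiff r q fun ⟨U, hU, hrU, hqU⟩ =>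
        hr (hblocks.1.eq_of_mem_mem hU hT hqU hq ▸ hrU)
      exact ⟨y * x, mul_mem hy hx, by simp [hxp, hyr]⟩
    · exact hdiff p q hpq
  · intro hqp g hg hfix
    by_contra hg1
    have hmem : (⟨g, hg⟩ : G) ∈ partsKernel G P := hfix
    have hbot : partsKernel G P ≠ ⊥ := fun h => by
      rw [h, Subgroup.mem_bot] at hmem
      exact hg1 (congrArg Subtype.val hmem)
    obtain ⟨S, hS, hne⟩ := hnontriv.2
    obtain ⟨s, hs⟩ := Setoid.nonempty_of_mem_partition hblocks.1 hS
    refine hne (Set.eq_univ_of_forall fun q => ?_)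
    obtain ⟨x, hx, rfl⟩ := hqp _ hblocks.normal_partsKernel hbot s q
    exact hx S hS ▸ Set.mem_image_of_mem _ hs
end

section
/- Let G satisfy Hypothesis (*), let T be the unique minimal normal subgroup of H (which exists and is unique since H is 2-transitive), and set Ĝ = G ∩ H^n. If Ĝ ≠ 1 (i.e., G is not block-faithful with respect to 𝓑), then at least one of the following holds: (i) T^n ≤ G; (ii) Ĝ is a full diagonal subgroup of L^n for some nontrivial normal subgroup L of H; (iii) T is abelian. -/
/-- The set `{g | P g}` (a set of elements of the base group of `Sym(α) ≀ Sym(ι)`) is a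
full diagonal subgroup of `L^n`: every coordinate projection maps it bijectively onto `L`. -/
def IsFullDiagonal {α ι : Type*} (P : Equiv.Perm (α × ι) → Prop)
    (L : Subgroup (Equiv.Perm α)) : Prop :=
  (∀ (i : ι) (σ : Equiv.Perm α), σ ∈ L ↔ ∃ g, P g ∧ ∀ b : α, g (b, i) = (σ b, i)) ∧
  (∀ (i : ι) (g g' : Equiv.Perm (α × ι)), P g → P g' →
    (∀ b : α, g (b, i) = g' (b, i)) → g = g')

section BurnsideTwoTransitive

open Equiv

theorem Is2Trans.exists_map_eq {α : Type*} {K : Subgroup (Perm α)} (hK : Is2Trans K) (a c : α) :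
    ∃ g ∈ K, g a = c := by
  obtain ⟨_, h⟩ := hK
  obtain ⟨b, hb⟩ := exists_ne a
  obtain ⟨d, hd⟩ := exists_ne c
  obtain ⟨g, hg, h1, -⟩ := h a b c d hb.symm hd.symm
  exact ⟨g, hg, h1⟩

variable {B : Type*}

theorem NormalIn.commute_of_inf_eq_bot {N M K : Subgroup (Perm B)} (hN : NormalIn N K)
    (hM : NormalIn M K) (h : N ⊓ M = ⊥) {x y : Perm B} (hx : x ∈ N) (hy : y ∈ M) :
    x * y = y * x := by
  have h1 : x * y * x⁻¹ * y⁻¹ ∈ N ⊓ M := by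
    refine ⟨?_, M.mul_mem (hM.2 x (hN.1 hx) y hy) (M.inv_mem hy)⟩
    change x * y * x⁻¹ * y⁻¹ ∈ N
    have := N.mul_mem hx (hN.2 y (hM.1 hy) _ (N.inv_mem hx))
    simpa only [mul_assoc] using this
  rw [h, Subgroup.mem_bot] at h1
  rwa [mul_inv_eq_one, mul_inv_eq_iff_eq_mul] at h1

theorem NormalIn.inf {N M K : Subgroup (Perm B)} (hN : NormalIn N K) (hM : NormalIn M K) :
    NormalIn (N ⊓ M) K :=
  ⟨inf_le_left.trans hN.1, fun g hg x hx => ⟨hN.2 g hg x hx.1, hM.2 g hg x hx.2⟩⟩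

theorem IsMinimalNormalIn.commute_of_ne {N M K : Subgroup (Perm B)} (hN : IsMinimalNormalIn N K)
    (hM : IsMinimalNormalIn M K) (h : N ≠ M) {x y : Perm B} (hx : x ∈ N) (hy : y ∈ M) :
    x * y = y * x := by
  refine hN.1.commute_of_inf_eq_bot hM.1 ?_ hx hy
  by_contra hb
  have hNM := hN.1.inf hM.1
  exact h ((hN.2.2 _ hNM hb inf_le_left).symm.trans (hM.2.2 _ hNM hb inf_le_right))

theorem NormalIn.exists_isMinimalNormalIn_le [Finite B] {N K : Subgroup (Perm B)}
    (hN : NormalIn N K) (h : N ≠ ⊥) : ∃ M, IsMinimalNormalIn M K ∧ M ≤ N := by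
  obtain ⟨M, hMN, hM⟩ := exists_minimal_le_of_wellFoundedLT
    (fun M : Subgroup (Perm B) => NormalIn M K ∧ M ≠ ⊥) N ⟨hN, h⟩
  exact ⟨M, ⟨hM.prop.1, hM.prop.2, fun P hP hb hPM => le_antisymm hPM (hM.2 ⟨hP, hb⟩ hPM)⟩, hMN⟩

theorem mem_map_conj {S : Subgroup (Perm B)} {h x : Perm B} :
    x ∈ S.map (MulAut.conj h).toMonoidHom ↔ h⁻¹ * x * h ∈ S := by
  constructor
  · rintro ⟨y, hy, rfl⟩
    simpa [mul_assoc] using hy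
  · intro hx
    exact ⟨_, hx, by simp [mul_assoc]⟩

theorem map_conj_ne_bot {S : Subgroup (Perm B)} (hS : S ≠ ⊥) (h : Perm B) :
    S.map (MulAut.conj h).toMonoidHom ≠ ⊥ := by
  rwa [Ne, Subgroup.map_eq_bot_iff_of_injective _ (MulAut.conj h).injective]

theorem NormalIn.map_conj {S T H : Subgroup (Perm B)} (hT : NormalIn T H) (hS : NormalIn S T)
    {h : Perm B} (hh : h ∈ H) : NormalIn (S.map (MulAut.conj h).toMonoidHom) T := by
  constructor
  · rintro _ ⟨y, hy, rfl⟩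
    exact hT.2 h hh y (hS.1 hy)
  · intro t ht x hx
    rw [mem_map_conj] at hx ⊢
    have ht' := hT.2 h⁻¹ (H.inv_mem hh) t ht
    have := hS.2 _ ht' _ hx
    simpa [mul_assoc] using this

theorem IsMinimalNormalIn.map_conj {S T H : Subgroup (Perm B)} (hT : NormalIn T H)
    (hS : IsMinimalNormalIn S T) {h : Perm B} (hh : h ∈ H) :
    IsMinimalNormalIn (S.map (MulAut.conj h).toMonoidHom) T := by
  refine ⟨hT.map_conj hS.1 hh, map_conj_ne_bot hS.2.1 h, fun N hN hb hle => ?_⟩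
  have h1 := hS.2.2 _ (hT.map_conj hN (H.inv_mem hh)) (map_conj_ne_bot hb h⁻¹) (by
    rintro _ ⟨y, hy, rfl⟩
    simpa using mem_map_conj.1 (hle hy))
  rw [← h1]
  ext x
  simp [mul_assoc]

/-- Let `F` be a family of at least two conjugate, pairwise commuting subgroups such that any two
points lie in a common orbit of some member. Then every member acts semiregularly. -/
theorem semiregular_of_commute {H : Subgroup (Perm B)} {F : Set (Subgroup (Perm B))}
    (hcomm : ∀ S₁ ∈ F, ∀ S₂ ∈ F, S₁ ≠ S₂ → ∀ x ∈ S₁, ∀ y ∈ S₂, x * y = y * x)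
    (hcover : ∀ a b : B, ∃ S ∈ F, ∃ s ∈ S, s a = b)
    (hconj : ∀ S₁ ∈ F, ∀ S₂ ∈ F, ∃ g ∈ H, ∀ y ∈ S₁, g * y * g⁻¹ ∈ S₂)
    (hne : ∀ S₁ ∈ F, ∃ S₂ ∈ F, S₁ ≠ S₂)
    {S : Subgroup (Perm B)} (hS : S ∈ F) {x : Perm B} (hx : x ∈ S) {a : B} (hxa : x a = a) :
    x = 1 := by
  have hfix : ∀ S₂ ∈ F, S ≠ S₂ → ∀ y ∈ S₂, x (y a) = y a := by
    intro S₂ hS₂ hn y hy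
    rw [← Perm.mul_apply, hcomm S hS S₂ hS₂ hn x hx y hy, Perm.mul_apply, hxa]
  by_cases htr : ∀ b, ∃ s ∈ S, s a = b
  · obtain ⟨S₂, hS₂, hn⟩ := hne S hS
    obtain ⟨g, -, hg⟩ := hconj S hS S₂ hS₂
    ext b
    obtain ⟨u, hu, hua⟩ := htr (g⁻¹ a)
    obtain ⟨v, hv, hvb⟩ := htr (g⁻¹ b)
    have h1 := hfix S₂ hS₂ hn _ (hg _ (S.mul_mem hv (S.inv_mem hu)))
    have h2 : (g * (v * u⁻¹) * g⁻¹) a = b := by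
      rw [Perm.mul_apply, Perm.mul_apply, Perm.mul_apply, ← hua]
      simp [hvb]
    rw [h2] at h1
    exact h1
  · push Not at htr
    obtain ⟨c, hc⟩ := htr
    have hout : ∀ d, (∀ s ∈ S, s a ≠ d) → x d = d := by
      intro d hd
      obtain ⟨S₂, hS₂, y, hy, rfl⟩ := hcover a d
      exact hfix S₂ hS₂ (fun h => hd y (h ▸ hy) rfl) y hy
    ext b
    by_cases hb : ∃ u ∈ S, u a = b
    · obtain ⟨u, hu, rfl⟩ := hb
      obtain ⟨S₂, hS₂, y, hy, rfl⟩ := hcover a c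
      have hn : S ≠ S₂ := fun h => hc y (h ▸ hy) rfl
      have h1 : x (u (y a)) = u (y a) := by
        refine hout _ fun s hs h => hc (u⁻¹ * s) (S.mul_mem (S.inv_mem hu) hs) ?_
        rw [Perm.mul_apply, h, Perm.inv_eq_iff_eq]
      have h2 : u (y a) = y (u a) := by
        rw [← Perm.mul_apply, hcomm S hS S₂ hS₂ hn u hu y hy, Perm.mul_apply]
      rw [h2, ← Perm.mul_apply, hcomm S hS S₂ hS₂ hn x hx y hy, Perm.mul_apply] at h1
      exact y.injective h1
    · push Not at hb
      exact hout b hb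

theorem pow_apply_eq_of_commute {x y : Perm B} (h : x * y = y * x) {a : B} (hxy : x a = y a)
    (m : ℕ) : (x ^ m) a = (y ^ m) a := by
  induction m with
  | zero => rfl
  | succ m ih =>
    have hc : Commute x (y ^ m) := Commute.pow_right h m
    rw [pow_succ', Perm.mul_apply, ih, ← Perm.mul_apply, hc.eq, Perm.mul_apply, hxy, pow_succ,
      Perm.mul_apply]

/-- Burnside: a minimal normal subgroup of a finite `2`-transitive group is abelian or simple. -/
theorem IsMinimalNormalIn.comm_or_eq_of_is2Trans [Finite B] {S T H : Subgroup (Perm B)}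
    (hH : Is2Trans H) (hT : IsMinimalNormalIn T H) (hS : IsMinimalNormalIn S T) :
    (∀ x ∈ T, ∀ y ∈ T, x * y = y * x) ∨ S = T := by
  by_cases hST : S = T
  · exact Or.inr hST
  left
  let F : Set (Subgroup (Perm B)) := {N | ∃ h ∈ H, S.map (MulAut.conj h).toMonoidHom = N}
  have hSF : S ∈ F := ⟨1, H.one_mem, by ext x; simp⟩
  have hmin : ∀ N ∈ F, IsMinimalNormalIn N T := by
    rintro _ ⟨h, hh, rfl⟩
    exact hS.map_conj hT.1 hh
  have hcomm : ∀ S₁ ∈ F, ∀ S₂ ∈ F, S₁ ≠ S₂ → ∀ x ∈ S₁, ∀ y ∈ S₂, x * y = y * x :=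
    fun S₁ h₁ S₂ h₂ hn x hx y hy => (hmin S₁ h₁).commute_of_ne (hmin S₂ h₂) hn hx hy
  have hFconj : ∀ N ∈ F, ∀ g ∈ H, N.map (MulAut.conj g).toMonoidHom ∈ F := by
    rintro _ ⟨h, hh, rfl⟩ g hg
    exact ⟨g * h, H.mul_mem hg hh, by ext x; simp [mul_assoc]⟩
  obtain ⟨s₀, hs₀, hs₀1⟩ := S.bot_or_exists_ne_one.resolve_left hS.2.1
  have hcover' : ∀ s ∈ S, s ≠ 1 → ∀ a b : B, a ≠ b → ∃ N ∈ F, ∃ g ∈ H,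
      g * s * g⁻¹ ∈ N ∧ (g * s * g⁻¹) a = b := by
    intro s hs hs1 a b hab
    obtain ⟨c, hc⟩ : ∃ c, s c ≠ c := by
      by_contra! h
      exact hs1 (Perm.ext h)
    obtain ⟨g, hg, rfl, rfl⟩ := hH.2 c (s c) a b hc.symm hab
    exact ⟨_, hFconj S hSF g hg, g, hg, ⟨s, hs, rfl⟩, by simp⟩
  have hcover : ∀ a b : B, ∃ N ∈ F, ∃ s ∈ N, s a = b := by
    intro a b
    by_cases hab : a = b
    · exact ⟨S, hSF, 1, S.one_mem, hab⟩
    · obtain ⟨N, hN, g, -, h1, h2⟩ := hcover' s₀ hs₀ hs₀1 a b hab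
      exact ⟨N, hN, _, h1, h2⟩
  have hconj : ∀ S₁ ∈ F, ∀ S₂ ∈ F, ∃ g ∈ H, ∀ y ∈ S₁, g * y * g⁻¹ ∈ S₂ := by
    rintro _ ⟨h, hh, rfl⟩ _ ⟨k, hk, rfl⟩
    refine ⟨k * h⁻¹, H.mul_mem hk (H.inv_mem hh), fun y hy => ?_⟩
    rw [mem_map_conj] at hy ⊢
    simpa [mul_assoc] using hy
  have hne : ∀ S₁ ∈ F, ∃ S₂ ∈ F, S₁ ≠ S₂ := by
    intro S₁ h₁
    by_contra! hall
    refine hST (hT.2.2 S ⟨hS.1.1.trans hT.1.1, fun g hg x hx => ?_⟩ hS.2.1 hS.1.1)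
    rw [← hall S hSF, hall _ (hFconj S hSF g hg)]
    exact ⟨x, hx, rfl⟩
  have hsemi : ∀ N ∈ F, ∀ x ∈ N, ∀ a, x a = a → x = 1 :=
    fun N hN x hx a hxa => semiregular_of_commute hcomm hcover hconj hne hN hx hxa
  obtain ⟨a⟩ : Nonempty B := hH.1.to_nonempty
  have : Nontrivial S := (Subgroup.nontrivial_iff_ne_bot S).2 hS.2.1
  obtain ⟨p, hp, hpS⟩ := Nat.exists_prime_and_dvd (Finite.one_lt_card (α := S)).ne'
  have : Fact p.Prime := ⟨hp⟩
  obtain ⟨⟨s, hs⟩, hsp⟩ := exists_prime_orderOf_dvd_card' p hpS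
  rw [Subgroup.orderOf_mk] at hsp
  have hs1 : s ≠ 1 := by
    rintro rfl
    exact hp.one_lt.ne (by rw [← hsp, orderOf_one])
  have hexp : ∀ x ∈ S, x ^ p = 1 := by
    intro x hx
    by_cases hx1 : x = 1
    · rw [hx1, one_pow]
    obtain ⟨N, hN, g, hg, hgN, hga⟩ := hcover' s hs hs1 a (x a)
      (fun h => hx1 (hsemi S hSF x hx a h.symm))
    have hgp : (g * s * g⁻¹) ^ p = 1 := by
      rw [conj_pow, ← hsp, pow_orderOf_eq_one, mul_one, mul_inv_cancel]
    have hcx : x * (g * s * g⁻¹) = (g * s * g⁻¹) * x := by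
      by_cases hSN : S = N
      · have h1 := hsemi S hSF (x⁻¹ * (g * s * g⁻¹))
          (S.mul_mem (S.inv_mem hx) (hSN ▸ hgN)) a (by
            rw [Perm.mul_apply, hga, Perm.inv_eq_iff_eq])
        rw [← inv_mul_eq_one.1 h1]
      · exact hcomm S hSF N hN hSN x hx _ hgN
    refine hsemi S hSF _ (S.pow_mem hx p) a ?_
    rw [pow_apply_eq_of_commute hcx hga.symm p, hgp, Perm.one_apply]
  have hpg : IsPGroup p S := fun x => ⟨1, by
    rw [pow_one]
    exact Subtype.ext (hexp x x.2)⟩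
  have := hpg.center_nontrivial
  obtain ⟨⟨⟨z, hzS⟩, hzc⟩, hz1⟩ := exists_ne (1 : Subgroup.center S)
  replace hz1 : z ≠ 1 := fun h => hz1 (Subtype.ext (Subtype.ext h))
  have hzF : ∀ N ∈ F, ∀ y ∈ N, y * z = z * y := by
    intro N hN y hy
    by_cases hSN : N = S
    · subst hSN
      exact congrArg Subtype.val (Subgroup.mem_center_iff.1 hzc ⟨y, hy⟩)
    · exact hcomm N hN S hSF hSN y hy z hzS
  have hgen : sSup F = T := by
    have hle : sSup F ≤ T := sSup_le fun N hN => (hmin N hN).1.1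
    refine hT.2.2 _ ⟨hle.trans hT.1.1, fun g hg x hx => ?_⟩ ?_ hle
    · have h1 : sSup F ≤ (sSup F).comap (MulAut.conj g).toMonoidHom :=
        sSup_le fun N hN y hy => (le_sSup (hFconj N hN g hg) :) ⟨y, hy, rfl⟩
      exact h1 hx
    · intro hb
      exact hS.2.1 (le_bot_iff.1 (hb ▸ le_sSup hSF))
  have hzT : ∀ y ∈ T, y * z = z * y := by
    have h1 : sSup F ≤ Subgroup.centralizer {z} := sSup_le fun N hN y hy =>
      Subgroup.mem_centralizer_singleton_iff.2 (hzF N hN y hy)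
    intro y hy
    exact Subgroup.mem_centralizer_singleton_iff.1 (h1 (hgen ▸ hy))
  have hZ : T ⊓ Subgroup.centralizer (T : Set (Perm B)) = T := by
    refine hT.2.2 _ ⟨inf_le_left.trans hT.1.1, fun g hg x hx => ⟨hT.1.2 g hg x hx.1, ?_⟩⟩ ?_
      inf_le_left
    · refine Subgroup.mem_centralizer_iff.2 fun t ht => ?_
      have h1 := Subgroup.mem_centralizer_iff.1 hx.2 _ (hT.1.2 g⁻¹ (H.inv_mem hg) t ht)
      have h2 := congrArg (fun w => g * w * g⁻¹) h1
      simpa [mul_assoc] using h2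
    · intro hb
      have : z ∈ T ⊓ Subgroup.centralizer (T : Set (Perm B)) :=
        ⟨hS.1.1 hzS, Subgroup.mem_centralizer_iff.2 hzT⟩
      rw [hb] at this
      exact hz1 this
  intro x hx y hy
  rw [← hZ] at hy
  exact Subgroup.mem_centralizer_iff.1 hy.2 x hx

end BurnsideTwoTransitive

section BaseGroup

open Equiv

variable {B ι : Type*} {H T : Subgroup (Perm B)}

theorem IsMinimalNormalIn.le_of_unique [Finite B] (hTuniq : ∀ T', IsMinimalNormalIn T' H → T' = T)
    {N : Subgroup (Perm B)} (hN : NormalIn N H) (h : N ≠ ⊥) : T ≤ N := by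
  obtain ⟨M, hM, hMN⟩ := hN.exists_isMinimalNormalIn_le h
  exact hTuniq M hM ▸ hMN

/-- If `T` is the unique minimal normal subgroup of the `2`-transitive group `H` and is not abelian,
then it lies in every nontrivial subgroup of `H` that it normalises. -/
theorem IsMinimalNormalIn.le_of_normalizes [Finite B] (hH : Is2Trans H)
    (hT : IsMinimalNormalIn T H) (hTuniq : ∀ T', IsMinimalNormalIn T' H → T' = T)
    (hab : ¬ ∀ x ∈ T, ∀ y ∈ T, x * y = y * x) {M : Subgroup (Perm B)} (hMH : M ≤ H) (hM : M ≠ ⊥)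
    (hn : ∀ t ∈ T, ∀ x ∈ M, t * x * t⁻¹ ∈ M) : T ≤ M := by
  have hMT : NormalIn (M ⊓ T) T :=
    ⟨inf_le_right, fun t ht x hx => ⟨hn t ht x hx.1, hT.1.2 t (hT.1.1 ht) x hx.2⟩⟩
  by_cases hb : M ⊓ T = ⊥
  · exfalso
    have hcen : M ≤ H ⊓ Subgroup.centralizer (T : Set (Perm B)) := by
      refine fun m hm => ⟨hMH hm, Subgroup.mem_centralizer_iff.2 fun t ht => ?_⟩
      have h1 : t * m * t⁻¹ * m⁻¹ ∈ M ⊓ T := by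
        refine ⟨M.mul_mem (hn t ht m hm) (M.inv_mem hm), ?_⟩
        change t * m * t⁻¹ * m⁻¹ ∈ T
        have := T.mul_mem ht (hT.1.2 m (hMH hm) _ (T.inv_mem ht))
        simpa only [mul_assoc] using this
      rw [hb, Subgroup.mem_bot] at h1
      rwa [mul_inv_eq_one, mul_inv_eq_iff_eq_mul] at h1
    have hC : NormalIn (H ⊓ Subgroup.centralizer (T : Set (Perm B))) H := by
      refine ⟨inf_le_left, fun g hg x hx =>
        ⟨H.mul_mem (H.mul_mem hg hx.1) (H.inv_mem hg), ?_⟩⟩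
      refine Subgroup.mem_centralizer_iff.2 fun t ht => ?_
      have h1 := Subgroup.mem_centralizer_iff.1 hx.2 _ (hT.1.2 g⁻¹ (H.inv_mem hg) t ht)
      have h2 := congrArg (fun w => g * w * g⁻¹) h1
      simpa [mul_assoc] using h2
    have hTC := IsMinimalNormalIn.le_of_unique hTuniq hC
      (fun h => hM (le_bot_iff.1 (h ▸ hcen)))
    exact hab fun x hx y hy => Subgroup.mem_centralizer_iff.1 (hTC hy).2 x hx
  · obtain ⟨S, hS, hSM⟩ := hMT.exists_isMinimalNormalIn_le hb
    rcases hT.comm_or_eq_of_is2Trans hH hS with h | rfl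
    · exact absurd h hab
    · exact hSM.trans inf_le_left

/-- Trichotomy for a subgroup `D` of `H ^ ι` normalised by enough elements of `H ≀ X`. -/
theorem base_trichotomy [Finite B] [Finite ι] {X : Subgroup (Perm ι)} (hH : Is2Trans H)
    (hX : Is2Trans X) (hT : IsMinimalNormalIn T H)
    (hTuniq : ∀ T', IsMinimalNormalIn T' H → T' = T) (o : ι) (D : Subgroup (ι → Perm B))
    (hDH : ∀ t ∈ D, ∀ i, t i ∈ H)
    (hXD : ∀ x ∈ X, ∃ h : ι → Perm B, (∀ i, h i ∈ H) ∧
      ∀ t ∈ D, (fun i => h (x⁻¹ i) * t (x⁻¹ i) * (h (x⁻¹ i))⁻¹) ∈ D)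
    (hHD : ∀ σ ∈ H, ∀ t ∈ D, ∃ t' ∈ D, t' o = σ * t o * σ⁻¹) (hD : D ≠ ⊥) :
    (∀ t : ι → Perm B, (∀ i, t i ∈ T) → t ∈ D) ∨
    (∃ L : Subgroup (Perm B), NormalIn L H ∧ L ≠ ⊥ ∧
      (∀ i σ, σ ∈ L ↔ ∃ t ∈ D, t i = σ) ∧ ∀ i, ∀ t ∈ D, ∀ t' ∈ D, t i = t' i → t = t') ∨
    (∀ x ∈ T, ∀ y ∈ T, x * y = y * x) := by
  classical
  by_cases hab : ∀ x ∈ T, ∀ y ∈ T, x * y = y * x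
  · exact Or.inr (Or.inr hab)
  let L : Subgroup (Perm B) := D.map (Pi.evalMonoidHom _ o)
  have hLH : NormalIn L H := by
    constructor
    · rintro _ ⟨t, ht, rfl⟩
      exact hDH t ht o
    · rintro g hg _ ⟨t, ht, rfl⟩
      obtain ⟨t', ht', h⟩ := hHD g hg t ht
      exact ⟨t', ht', h⟩
  have hmove : ∀ x ∈ X, ∃ h : ι → Perm B, (∀ i, h i ∈ H) ∧
      ∀ t ∈ D, ∃ t' ∈ D, ∀ i, t' (x i) = h i * t i * (h i)⁻¹ := by
    intro x hx
    obtain ⟨h, hh, hD'⟩ := hXD x hx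
    exact ⟨h, hh, fun t ht => ⟨_, hD' t ht, fun i => by simp⟩⟩
  have hL : ∀ i σ, σ ∈ L ↔ ∃ t ∈ D, t i = σ := by
    intro i σ
    constructor
    · intro hσ
      obtain ⟨x, hx, rfl⟩ := hX.exists_map_eq o i
      obtain ⟨h, hh, hD'⟩ := hmove x hx
      obtain ⟨t, ht, hto⟩ := hLH.2 _ (H.inv_mem (hh o)) σ hσ
      obtain ⟨t', ht', h1⟩ := hD' t ht
      refine ⟨t', ht', ?_⟩
      rw [h1, show t o = _ from hto]
      simp [mul_assoc]
    · rintro ⟨t, ht, rfl⟩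
      obtain ⟨x, hx, hxi⟩ := hX.exists_map_eq i o
      obtain ⟨h, hh, hD'⟩ := hmove x hx
      obtain ⟨t', ht', h1⟩ := hD' t ht
      have h2 : h i * t i * (h i)⁻¹ ∈ L := ⟨t', ht', by rw [← h1, hxi]; rfl⟩
      have h3 := hLH.2 _ (H.inv_mem (hh i)) _ h2
      simpa [mul_assoc] using h3
  have hLb : L ≠ ⊥ := by
    intro hb
    refine hD ((Subgroup.eq_bot_iff_forall _).2 fun t ht => funext fun i => ?_)
    have := (hL i (t i)).2 ⟨t, ht, rfl⟩
    rw [hb] at this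
    exact this
  have hTL : T ≤ L := IsMinimalNormalIn.le_of_unique hTuniq hLH hLb
  by_cases hinj : ∀ i, ∀ t ∈ D, ∀ t' ∈ D, t i = t' i → t = t'
  · exact Or.inr (Or.inl ⟨L, hLH, hLb, hL, hinj⟩)
  left
  push Not at hinj
  obtain ⟨i₀, t₁, ht₁, t₂, ht₂, h12, hne⟩ := hinj
  obtain ⟨j₀, hj₀⟩ := Function.ne_iff.1 hne
  have hij₀ : i₀ ≠ j₀ := fun h => hj₀ (h ▸ h12)
  have hsep : ∀ i j, i ≠ j → ∃ t ∈ D, t i = 1 ∧ t j ≠ 1 := by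
    intro i j hij
    obtain ⟨x, hx, rfl, rfl⟩ := hX.2 i₀ j₀ i j hij₀ hij
    obtain ⟨h, -, hD'⟩ := hmove x hx
    obtain ⟨t', ht', h1⟩ := hD' (t₁ * t₂⁻¹) (D.mul_mem ht₁ (D.inv_mem ht₂))
    refine ⟨t', ht', ?_, ?_⟩
    · rw [h1]
      simp [h12]
    · rw [h1, Ne, conj_eq_one_iff]
      simpa [mul_inv_eq_one] using hj₀
  have hfill : ∀ (s : Set ι) (j : ι), (∃ t ∈ D, (∀ i ∈ s, t i = 1) ∧ t j ≠ 1) →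
      ∀ σ ∈ T, ∃ t ∈ D, (∀ i ∈ s, t i = 1) ∧ t j = σ := by
    rintro s j ⟨t, ht, hts, htj⟩
    let M : Subgroup (Perm B) :=
      (D ⊓ Subgroup.pi s fun _ => ⊥).map (Pi.evalMonoidHom (fun _ : ι => Perm B) j)
    have hTM : T ≤ M := by
      refine hT.le_of_normalizes hH hTuniq hab ?_ ?_ ?_
      · rintro _ ⟨u, hu, rfl⟩
        exact hDH u hu.1 j
      · intro hb
        have : t j ∈ M := ⟨t, ⟨ht, fun i hi => hts i hi⟩, rfl⟩
        rw [hb] at this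
        exact htj this
      · rintro σ hσ _ ⟨u, hu, rfl⟩
        obtain ⟨v, hv, rfl⟩ := (hL j σ).1 (hTL hσ)
        refine ⟨v * u * v⁻¹, ⟨D.mul_mem (D.mul_mem hv hu.1) (D.inv_mem hv), fun i hi => ?_⟩, rfl⟩
        have : u i = 1 := hu.2 i hi
        simp [this]
    intro σ hσ
    obtain ⟨u, hu, hσ⟩ := hTM hσ
    exact ⟨u, hu.1, fun i hi => hu.2 i hi, hσ⟩
  have hfin : ∀ (s : Finset ι) (j : ι), j ∉ s →
      ∀ σ ∈ T, ∃ t ∈ D, (∀ i ∈ s, t i = 1) ∧ t j = σ := by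
    intro s j
    induction s using Finset.induction_on with
    | empty =>
      intro _ σ hσ
      obtain ⟨t, ht, h⟩ := (hL j σ).1 (hTL hσ)
      exact ⟨t, ht, by simp, h⟩
    | insert i s his ih =>
      intro hj
      rw [Finset.mem_insert, not_or] at hj
      refine hfill (insert i s : Finset ι) j ?_
      push Not at hab
      obtain ⟨x, hx, y, hy, hxy⟩ := hab
      obtain ⟨t, ht, hts, rfl⟩ := ih hj.2 x hx
      obtain ⟨u, hu, hui, huj⟩ := hsep i j (Ne.symm hj.1)
      obtain ⟨u, hu, hui, rfl⟩ := hfill {i} j ⟨u, hu, by simpa using hui, huj⟩ y hy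
      refine ⟨t * u * t⁻¹ * u⁻¹, D.mul_mem (D.mul_mem (D.mul_mem ht hu) (D.inv_mem ht))
        (D.inv_mem hu), ?_, ?_⟩
      · intro k hk
        rcases Finset.mem_insert.1 (Finset.mem_coe.1 hk) with rfl | hk
        · simp [hui k rfl]
        · simp [hts k hk]
      · intro h
        apply hxy
        simpa [mul_inv_eq_one, mul_inv_eq_iff_eq_mul] using h
  intro t ht
  have := Fintype.ofFinite ι
  refine Subgroup.pi_mem_of_mulSingle_mem t fun j => ?_
  obtain ⟨u, hu, hu1, huj⟩ := hfin (Finset.univ.erase j) j (by simp) (t j) (ht j)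
  convert hu
  ext1 i
  by_cases hij : i = j
  · subst hij
    simp [huj]
  · rw [Pi.mulSingle_eq_of_ne hij, hu1 i (by simp [hij])]

/-- The embedding of the base group `Sym(B) ^ ι` into `Sym(B × ι)`. -/
def baseHom (B ι : Type*) : (ι → Perm B) →* Perm (B × ι) where
  toFun t := prodCongrLeft t
  map_one' := rfl
  map_mul' _ _ := rfl

@[simp]
theorem baseHom_apply (t : ι → Perm B) (b : B) (i : ι) : baseHom B ι t (b, i) = (t i b, i) := rfl

theorem conj_baseHom {g : Perm (B × ι)} {h : ι → Perm B} {x : Perm ι}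
    (hg : ∀ p : B × ι, g p = (h p.2 p.1, x p.2)) (t : ι → Perm B) :
    baseHom B ι (fun i => h (x⁻¹ i) * t (x⁻¹ i) * (h (x⁻¹ i))⁻¹) = g * baseHom B ι t * g⁻¹ := by
  rw [eq_mul_inv_iff_mul_eq]
  ext1 ⟨b, i⟩
  simp [hg]

end BaseGroup

/-- let `G` satisfy Hypothesis (*), let `T` be the unique minimal normal
subgroup of `H`, and suppose `Ĝ = G ∩ Hⁿ` is nontrivial (`G` is not block-faithful).
Then either `Tⁿ ≤ G`, or `Ĝ` is a full diagonal subgroup of `Lⁿ` for some nontrivial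
normal subgroup `L` of `H`, or `T` is abelian. -/
theorem stmt_7 {B : Type*} [Fintype B] {n : ℕ} (hn : 2 ≤ n)
    (H T : Subgroup (Equiv.Perm B)) (X : Subgroup (Equiv.Perm (Fin n)))
    (hH : Is2Trans H) (hX : Is2Trans X)
    (G : Subgroup (Equiv.Perm (B × Fin n)))
    (hGw : ∀ g ∈ G, InWreath H X g)
    (hproj : ProjEq G X)
    (hcomp : ComponentEq G (⟨0, by omega⟩ : Fin n) H)
    (hT : IsMinimalNormalIn T H)
    (hTuniq : ∀ T' : Subgroup (Equiv.Perm B), IsMinimalNormalIn T' H → T' = T)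
    (hker : ∃ g ∈ G, g ≠ 1 ∧ ∀ p : B × Fin n, (g p).2 = p.2) :
    (∀ g : Equiv.Perm (B × Fin n), InBase T g → g ∈ G) ∨
    (∃ L : Subgroup (Equiv.Perm B), NormalIn L H ∧ L ≠ ⊥ ∧
      IsFullDiagonal (fun g => g ∈ G ∧ ∀ p : B × Fin n, (g p).2 = p.2) L) ∨
    (∀ x ∈ T, ∀ y ∈ T, x * y = y * x) := by
  classical
  have := hH.1
  set o : Fin n := ⟨0, by omega⟩
  obtain ⟨b₀⟩ : Nonempty B := hH.1.to_nonempty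
  have hbase : ∀ g ∈ G, (∀ p : B × Fin n, (g p).2 = p.2) →
      ∃ t : Fin n → Equiv.Perm B, baseHom B (Fin n) t = g := by
    intro g hg hfix
    obtain ⟨h, x, -, -, hgx⟩ := hGw g hg
    refine ⟨h, Equiv.ext fun ⟨b, i⟩ => Prod.ext ?_ ?_⟩
    · simp [hgx]
    · exact (hfix (b, i)).symm
  have hconj : ∀ g ∈ G, ∀ t ∈ G.comap (baseHom B (Fin n)), g * baseHom B (Fin n) t * g⁻¹ ∈ G :=
    fun g hg t ht => G.mul_mem (G.mul_mem hg ht) (G.inv_mem hg)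
  have key := base_trichotomy hH hX hT hTuniq o (G.comap (baseHom B (Fin n))) ?_ ?_ ?_ ?_
  · rcases key with h | ⟨L, hLH, hLb, hL, hinj⟩ | h
    · left
      rintro g ⟨t, ht, hg⟩
      have : baseHom B (Fin n) t = g := Equiv.ext fun p => (hg p).symm
      exact this ▸ h t ht
    · refine Or.inr (Or.inl ⟨L, hLH, hLb, fun i σ => ?_, ?_⟩)
      · rw [hL i σ]
        constructor
        · rintro ⟨t, ht, rfl⟩
          exact ⟨_, ⟨ht, fun _ => rfl⟩, fun _ => rfl⟩
        · rintro ⟨g, ⟨hg, hfix⟩, hgσ⟩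
          obtain ⟨t, rfl⟩ := hbase g hg hfix
          exact ⟨t, hg, Equiv.ext fun b => congrArg Prod.fst (hgσ b)⟩
      · rintro i g g' ⟨hg, hfix⟩ ⟨hg', hfix'⟩ heq
        obtain ⟨t, rfl⟩ := hbase g hg hfix
        obtain ⟨t', rfl⟩ := hbase g' hg' hfix'
        rw [hinj i t hg t' hg' (Equiv.ext fun b => congrArg Prod.fst (heq b))]
    · exact Or.inr (Or.inr h)
  · intro t ht i
    obtain ⟨h, x, hh, -, hgx⟩ := hGw _ ht
    have : t i = h i := Equiv.ext fun b => congrArg Prod.fst (hgx (b, i))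
    exact this ▸ hh i
  · intro x hx
    obtain ⟨g, hg, hgx⟩ := (hproj x).1 hx
    obtain ⟨h, x', hh, -, hgx'⟩ := hGw g hg
    obtain rfl : x' = x := Equiv.ext fun i => by rw [← hgx (b₀, i), hgx']
    refine ⟨h, hh, fun t ht => ?_⟩
    rw [Subgroup.mem_comap, conj_baseHom hgx']
    exact hconj g hg t ht
  · intro σ hσ t ht
    obtain ⟨g, hg, hgσ⟩ := (hcomp σ).1 hσ
    obtain ⟨h, x, hh, -, hgx⟩ := hGw g hg
    refine ⟨_, Subgroup.mem_comap.2 (conj_baseHom hgx t ▸ hconj g hg t ht), ?_⟩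
    have hxo : x o = o := by
      have := congrArg Prod.snd (hgσ b₀)
      rwa [hgx] at this
    have hxo' : x⁻¹ o = o := Equiv.Perm.inv_eq_iff_eq.2 hxo.symm
    have hho : h o = σ := Equiv.ext fun b => by
      have := congrArg Prod.fst (hgσ b)
      rwa [hgx] at this
    simp only [hxo', hho]
  · obtain ⟨g, hg, hg1, hfix⟩ := hker
    obtain ⟨t, rfl⟩ := hbase g hg hfix
    intro hb
    have : t ∈ G.comap (baseHom B (Fin n)) := hg
    rw [hb, Subgroup.mem_bot] at this
    exact hg1 (by rw [this, map_one])
end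

section
/- Let H ≤ Sym(B) be 2-transitive and let G ≤ H ≀ S_n be a rank 3 imprimitive subgroup on B × {1,…,n} preserving the block system 𝓑 = {B_1,…,B_n} with B_ℓ = B × {ℓ}. Let K ≤ H^n be a subgroup of the base group that is normal in G, let i ∈ {1,…,n}, α ∈ B, and α_i = (α,i) ∈ B_i. Then for every j ≠ i, the projection π_j(K_{α_i}) of the stabiliser of α_i in K is half-transitive on B, i.e., all of its orbits on B have the same cardinality. -/
/-- In a rank `3` group preserving a nontrivial block system, any two pairs of points lying in
distinct blocks are in the same orbit. -/
theorem exists_map_pair_of_rank_three {B : Type*} [Nontrivial B] {ι : Type*}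
    (G : Subgroup (Equiv.Perm (B × ι)))
    (hG : ∀ g ∈ G, ∃ x : Equiv.Perm ι, ∀ p : B × ι, (g p).2 = x p.2)
    (hrank3 : Nat.card (MulAction.orbitRel.Quotient G ((B × ι) × (B × ι))) = 3)
    {p q p' q' : B × ι} (h : p.2 ≠ q.2) (h' : p'.2 ≠ q'.2) :
    ∃ g ∈ G, g p = p' ∧ g q = q' := by
  classical
  let mk : (B × ι) × (B × ι) → MulAction.orbitRel.Quotient G ((B × ι) × (B × ι)) :=
    fun u => Quotient.mk _ u
  have hmk : ∀ u v, mk u = mk v → ∃ g ∈ G, g v.1 = u.1 ∧ g v.2 = u.2 := by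
    intro u v huv
    obtain ⟨g, hg⟩ := MulAction.orbitRel_apply.1 (Quotient.exact huv)
    exact ⟨g, g.2, congrArg Prod.fst hg, congrArg Prod.snd hg⟩
  have hdiag : ∀ u v, mk u = mk v → (u.1 = u.2 ↔ v.1 = v.2) := by
    intro u v huv
    obtain ⟨g, -, h1, h2⟩ := hmk u v huv
    rw [← h1, ← h2, g.injective.eq_iff]
  have hblock : ∀ u v, mk u = mk v → (u.1.2 = u.2.2 ↔ v.1.2 = v.2.2) := by
    intro u v huv
    obtain ⟨g, hg, h1, h2⟩ := hmk u v huv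
    obtain ⟨x, hx⟩ := hG g hg
    rw [← h1, ← h2, hx, hx, x.injective.eq_iff]
  by_contra hne
  obtain ⟨c, hc⟩ := exists_ne p.1
  have hpc : p ≠ (c, p.2) := fun e => hc (congrArg Prod.fst e).symm
  have hpq : p ≠ q := fun e => h (congrArg Prod.snd e)
  have hpq' : p' ≠ q' := fun e => h' (congrArg Prod.snd e)
  have : Finite (MulAction.orbitRel.Quotient G ((B × ι) × (B × ι))) :=
    Nat.finite_of_card_ne_zero (by omega)
  have := Fintype.ofFinite (MulAction.orbitRel.Quotient G ((B × ι) × (B × ι)))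
  have h01 : mk (p, p) ≠ mk (p, (c, p.2)) := fun e => hpc ((hdiag _ _ e).1 rfl)
  have h02 : mk (p, p) ≠ mk (p, q) := fun e => hpq ((hdiag _ _ e).1 rfl)
  have h03 : mk (p, p) ≠ mk (p', q') := fun e => hpq' ((hdiag _ _ e).1 rfl)
  have h12 : mk (p, (c, p.2)) ≠ mk (p, q) := fun e => h ((hblock _ _ e).1 rfl)
  have h13 : mk (p, (c, p.2)) ≠ mk (p', q') := fun e => h' ((hblock _ _ e).1 rfl)
  have h23 : mk (p, q) ≠ mk (p', q') := fun e => hne (hmk _ _ e.symm)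
  have hcard : ({mk (p, p), mk (p, (c, p.2)), mk (p, q), mk (p', q')} : Finset _).card = 4 := by
    simp [h01, h02, h03, h12, h13, h23]
  have hle := Finset.card_le_univ
    ({mk (p, p), mk (p, (c, p.2)), mk (p, q), mk (p', q')} : Finset _)
  rw [hcard, ← Nat.card_eq_fintype_card, hrank3] at hle
  omega

/-- let `H ≤ Sym(B)` be 2-transitive and `G ≤ H ≀ Sₙ` a rank 3 imprimitive
subgroup of `Sym(B × Fin n)` preserving the blocks `B × {ℓ}`. Let `K ≤ Hⁿ` (a subgroup
of the base group) be normal in `G`, let `αᵢ = (α, i)`. Then for every `j ≠ i`, the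
`j`-th projection of the stabiliser of `αᵢ` in `K` is half-transitive on `B`: all of
its orbits have the same cardinality. -/
theorem stmt_8 {B : Type*} [Fintype B] {n : ℕ} (hn : 2 ≤ n)
    (H : Subgroup (Equiv.Perm B)) (hH : Is2Trans H)
    (G : Subgroup (Equiv.Perm (B × Fin n)))
    (hGw : ∀ g ∈ G, ∃ (h : Fin n → Equiv.Perm B) (x : Equiv.Perm (Fin n)),
      (∀ i, h i ∈ H) ∧ ∀ p : B × Fin n, g p = (h p.2 p.1, x p.2))
    (htrans : ∀ p q : B × Fin n, ∃ g ∈ G, g p = q)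
    (hrank3 : Nat.card
      (MulAction.orbitRel.Quotient G ((B × Fin n) × (B × Fin n))) = 3)
    (K : Subgroup (Equiv.Perm (B × Fin n)))
    (hKG : K ≤ G)
    (hKbase : ∀ g ∈ K, ∃ h : Fin n → Equiv.Perm B,
      (∀ i, h i ∈ H) ∧ ∀ p : B × Fin n, g p = (h p.2 p.1, p.2))
    (hKnormal : ∀ g ∈ G, ∀ k ∈ K, g * k * g⁻¹ ∈ K)
    (i : Fin n) (α : B) :
    ∀ j : Fin n, j ≠ i → ∀ b b' : B,
      Nat.card {c : B | ∃ g ∈ K, g (α, i) = (α, i) ∧ g (b, j) = (c, j)} =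
      Nat.card {c : B | ∃ g ∈ K, g (α, i) = (α, i) ∧ g (b', j) = (c, j)} := by
  intro j hj b b'
  have := hH.1
  have hle : ∀ b b' : B,
      Nat.card {c : B | ∃ g ∈ K, g (α, i) = (α, i) ∧ g (b, j) = (c, j)} ≤
      Nat.card {c : B | ∃ g ∈ K, g (α, i) = (α, i) ∧ g (b', j) = (c, j)} := by
    intro b b'
    obtain ⟨g, hg, h1, h2⟩ := exists_map_pair_of_rank_three G
      (fun g hg => by
        obtain ⟨h, x, -, hx⟩ := hGw g hg
        exact ⟨x, fun p => by rw [hx]⟩) hrank3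
      (p := (α, i)) (q := (b, j)) (p' := (α, i)) (q' := (b', j)) hj.symm hj.symm
    obtain ⟨h, x, -, hx⟩ := hGw g hg
    have hxj : x j = j := by simpa [hx] using congrArg Prod.snd h2
    refine Set.ncard_le_ncard_of_injOn (h j) ?_ (h j).injective.injOn (Set.toFinite _)
    rintro c ⟨k, hk, hk1, hk2⟩
    refine ⟨g * k * g⁻¹, hKnormal g hg k hk, ?_, ?_⟩
    · rw [Equiv.Perm.mul_apply, Equiv.Perm.mul_apply, Equiv.Perm.inv_eq_iff_eq.2 h1.symm, hk1, h1]
    · rw [Equiv.Perm.mul_apply, Equiv.Perm.mul_apply, Equiv.Perm.inv_eq_iff_eq.2 h2.symm, hk2, hx,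
        hxj]
  exact le_antisymm (hle b b') (hle b' b)
end

section
/- Suppose G is a rank 3 group satisfying Hypothesis (*) such that n = 2, and assume Ĝ = G ∩ (H × H) is a full diagonal subgroup of H × H. Then there exist an automorphism φ of H and a point α ∈ B such that (H_α)^φ is transitive on B. -/
/-- The elements of `G` that fix every block `α × {i}` setwise. -/
def blockKernel {α ι : Type*} (G : Subgroup (Equiv.Perm (α × ι))) :
    Subgroup (Equiv.Perm (α × ι)) where
  carrier := {g | g ∈ G ∧ ∀ p : α × ι, (g p).2 = p.2}
  one_mem' := ⟨G.one_mem, fun _ => rfl⟩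
  mul_mem' := fun {g k} hg hk =>
    ⟨G.mul_mem hg.1 hk.1, fun p => (hg.2 (k p)).trans (hk.2 p)⟩
  inv_mem' := fun {g} hg => ⟨G.inv_mem hg.1, fun p => by
    have := hg.2 (g⁻¹ p)
    rw [Equiv.Perm.coe_inv, Equiv.apply_symm_apply] at this
    exact this.symm⟩

/-- If the block kernel is a full diagonal subgroup, each coordinate projection inverts to an
isomorphism from `L` to the block kernel. -/
lemma exists_mulEquiv_blockKernel {α ι : Type*} {L : Subgroup (Equiv.Perm α)}
    {X : Subgroup (Equiv.Perm ι)} {G : Subgroup (Equiv.Perm (α × ι))}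
    (hGw : ∀ g ∈ G, InWreath L X g)
    (hdiag : IsFullDiagonal (fun g => g ∈ G ∧ ∀ p : α × ι, (g p).2 = p.2) L) (i : ι) :
    ∃ e : L ≃* blockKernel G, ∀ (σ : L) (b : α),
      (e σ : Equiv.Perm (α × ι)) (b, i) = ((σ : Equiv.Perm α) b, i) := by
  choose f hfK hf using fun σ : L => (hdiag.1 i σ).1 σ.2
  let F : L →* blockKernel G := MonoidHom.mk' (fun σ => ⟨f σ, hfK σ⟩) fun σ τ => by
    refine Subtype.ext (hdiag.2 i _ _ (hfK _) ((blockKernel G).mul_mem (hfK σ) (hfK τ)) ?_)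
    intro b
    change f (σ * τ) (b, i) = f σ (f τ (b, i))
    rw [hf τ, hf σ, hf (σ * τ)]
    rfl
  have hF : Function.Bijective F := by
    constructor
    · intro σ τ h
      have h' : f σ = f τ := congrArg Subtype.val h
      refine Subtype.ext (Equiv.ext fun b => ?_)
      have := (hf σ b).symm.trans ((congrArg (fun g => g (b, i)) h').trans (hf τ b))
      exact (Prod.ext_iff.1 this).1
    · rintro ⟨g, hg⟩
      obtain ⟨h, x, hh, -, hgx⟩ := hGw g hg.1
      refine ⟨⟨h i, hh i⟩, Subtype.ext (hdiag.2 i _ _ (hfK _) hg fun b => ?_)⟩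
      refine (hf _ b).trans ?_
      exact Prod.ext (congrArg Prod.fst (hgx (b, i))).symm (hg.2 (b, i)).symm
  exact ⟨MulEquiv.ofBijective F hF, hf⟩

open Classical in
/-- The relation between two points of `α × ι` with respect to the blocks `α × {i}`:
equal, distinct in the same block, or in different blocks. -/
noncomputable def blockRelation {α ι : Type*} (q : (α × ι) × (α × ι)) : Fin 3 :=
  if q.1 = q.2 then 0 else if q.1.2 = q.2.2 then 1 else 2

lemma blockRelation_smul {α ι : Type*} {H : Subgroup (Equiv.Perm α)}
    {X : Subgroup (Equiv.Perm ι)} {G : Subgroup (Equiv.Perm (α × ι))}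
    (hGw : ∀ g ∈ G, InWreath H X g) (g : G) (q : (α × ι) × (α × ι)) :
    blockRelation (g • q) = blockRelation q := by
  obtain ⟨h, x, -, -, hgx⟩ := hGw g g.2
  have h₁ : (g • q).1 = (g • q).2 ↔ q.1 = q.2 := (g : Equiv.Perm (α × ι)).injective.eq_iff
  have h₂ : (g • q).1.2 = (g • q).2.2 ↔ q.1.2 = q.2.2 := by
    change ((g : Equiv.Perm (α × ι)) q.1).2 = ((g : Equiv.Perm (α × ι)) q.2).2 ↔ _
    rw [hgx, hgx]
    exact x.injective.eq_iff
  unfold blockRelation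
  split_ifs <;> first | rfl | tauto

/-- In a rank 3 group preserving a nontrivial block system, the orbit of a pair of points is
determined by its relation to the blocks. -/
lemma mem_orbit_of_blockRelation_eq {α ι : Type*} [Nontrivial α] [Nontrivial ι]
    {H : Subgroup (Equiv.Perm α)}
    {X : Subgroup (Equiv.Perm ι)} {G : Subgroup (Equiv.Perm (α × ι))}
    (hGw : ∀ g ∈ G, InWreath H X g)
    (hrank3 : Nat.card
      (MulAction.orbitRel.Quotient G ((α × ι) × (α × ι))) = 3)
    {q r : (α × ι) × (α × ι)} (hqr : blockRelation q = blockRelation r) :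
    q ∈ MulAction.orbit G r := by
  let c : MulAction.orbitRel.Quotient G ((α × ι) × (α × ι)) → Fin 3 :=
    Quotient.lift blockRelation (by
      rintro _ q ⟨g, rfl⟩
      exact blockRelation_smul hGw g q)
  obtain ⟨a, b, hab⟩ := exists_pair_ne α
  obtain ⟨i, j, hij⟩ := exists_pair_ne ι
  have hsurj : Function.Surjective c := by
    intro k
    fin_cases k
    · exact ⟨Quotient.mk _ ((a, i), (a, i)), by simp [c, blockRelation]⟩
    · exact ⟨Quotient.mk _ ((a, i), (b, i)), by simp [c, blockRelation, hab]⟩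
    · exact ⟨Quotient.mk _ ((a, i), (a, j)), by simp [c, blockRelation, hij]⟩
  have hfin : Finite (MulAction.orbitRel.Quotient G ((α × ι) × (α × ι))) :=
    Nat.finite_of_card_ne_zero (by rw [hrank3]; decide)
  have hbij : Function.Bijective c :=
    (Nat.bijective_iff_surjective_and_card c).2 ⟨hsurj, by rw [hrank3, Nat.card_fin]⟩
  have h : (Quotient.mk _ q : MulAction.orbitRel.Quotient G ((α × ι) × (α × ι))) =
      Quotient.mk _ r := hbij.1 hqr
  exact MulAction.orbitRel_apply.1 (Quotient.exact h)

/-- suppose `G` is a rank 3 group satisfying Hypothesis (*) with `n = 2`,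
and `Ĝ = G ∩ (H × H)` is a full diagonal subgroup of `H × H`. Then there are an
automorphism `φ` of `H` and a point `α ∈ B` such that `(H_α)^φ` is transitive on `B`. -/
theorem stmt_10 {B : Type*} [Fintype B]
    (H : Subgroup (Equiv.Perm B)) (X : Subgroup (Equiv.Perm (Fin 2)))
    (hH : Is2Trans H) (hX : Is2Trans X)
    (G : Subgroup (Equiv.Perm (B × Fin 2)))
    (hGw : ∀ g ∈ G, InWreath H X g)
    (hproj : ProjEq G X)
    (hcomp : ComponentEq G (0 : Fin 2) H)
    (hrank3 : Nat.card
      (MulAction.orbitRel.Quotient G ((B × Fin 2) × (B × Fin 2))) = 3)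
    (hdiag : IsFullDiagonal (fun g => g ∈ G ∧ ∀ p : B × Fin 2, (g p).2 = p.2) H) :
    ∃ (φ : H ≃* H) (α : B), ∀ b c : B,
      ∃ h : H, h ∈ Subgroup.map φ.toMonoidHom (MulAction.stabilizer H α) ∧
        (h : Equiv.Perm B) b = c := by
  have : Nontrivial B := hH.1
  obtain ⟨e₀, he₀⟩ := exists_mulEquiv_blockKernel hGw hdiag 0
  obtain ⟨e₁, he₁⟩ := exists_mulEquiv_blockKernel hGw hdiag 1
  obtain ⟨a⟩ : Nonempty B := inferInstance
  refine ⟨e₀.trans e₁.symm, a, fun b c => ?_⟩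
  obtain ⟨g, hg⟩ := mem_orbit_of_blockRelation_eq (q := ((a, (0 : Fin 2)), (c, 1)))
    (r := ((a, 0), (b, 1))) hGw hrank3 (by simp [blockRelation])
  have hga : (g : Equiv.Perm (B × Fin 2)) (a, 0) = (a, 0) := congrArg Prod.fst hg
  have hgb : (g : Equiv.Perm (B × Fin 2)) (b, 1) = (c, 1) := congrArg Prod.snd hg
  have hgK : (g : Equiv.Perm (B × Fin 2)) ∈ blockKernel G := by
    refine ⟨g.2, ?_⟩
    obtain ⟨h, x, -, -, hgx⟩ := hGw g g.2
    have hx₀ : x 0 = 0 := congrArg Prod.snd ((hgx (a, 0)).symm.trans hga)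
    have hx₁ : x 1 = 1 := congrArg Prod.snd ((hgx (b, 1)).symm.trans hgb)
    rintro ⟨d, i⟩
    rw [hgx]
    fin_cases i
    · exact hx₀
    · exact hx₁
  refine ⟨e₁.symm ⟨g, hgK⟩, ⟨e₀.symm ⟨g, hgK⟩, ?_, ?_⟩, ?_⟩
  · have := he₀ (e₀.symm ⟨g, hgK⟩) a
    rw [MulEquiv.apply_symm_apply] at this
    exact congrArg Prod.fst (this.symm.trans hga)
  · simp
  · have := he₁ (e₁.symm ⟨g, hgK⟩) b
    rw [MulEquiv.apply_symm_apply] at this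
    exact congrArg Prod.fst (this.symm.trans hgb)
end

section
/- Suppose that G ≤ Sym(Ω) satisfies Hypothesis (*), with system of imprimitivity 𝓑 consisting of n blocks of size m, and that G has rank 3. Then for B ∈ 𝓑: (E) the action of the setwise stabiliser G_B on B is not isomorphic to the action of G_B on 𝓑 \ {B}, i.e., for v ∈ B and B′ ∈ 𝓑 \ {B} the subgroups G_{B,v} and G_{B,B′} are not conjugate in G_B; and (F) for v ∈ B, there is no normal subgroup N of G with G_v = G_B ∩ N. -/
open Pointwise in
/-- The setwise stabiliser in `Sym(B × Fin n)` of the block `B × {i}`. -/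
def blockStab (B : Type*) {n : ℕ} (i : Fin n) : Subgroup (Equiv.Perm (B × Fin n)) :=
  MulAction.stabilizer (Equiv.Perm (B × Fin n)) ({p : B × Fin n | p.2 = i} : Set (B × Fin n))

theorem InWreath.snd_apply_eq_iff {α ι : Type*} {H : Subgroup (Equiv.Perm α)}
    {X : Subgroup (Equiv.Perm ι)} {g : Equiv.Perm (α × ι)} (hg : InWreath H X g) (p q : α × ι) :
    (g p).2 = (g q).2 ↔ p.2 = q.2 := by
  obtain ⟨h, x, -, -, hgx⟩ := hg
  simp [hgx]

theorem mem_blockStab_iff {B : Type*} {n : ℕ} {i : Fin n} {g : Equiv.Perm (B × Fin n)} :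
    g ∈ blockStab B i ↔ ∀ p, (g p).2 = i ↔ p.2 = i := by
  rw [blockStab, MulAction.mem_stabilizer_set]
  rfl

theorem InWreath.mem_blockStab {B : Type*} {n : ℕ} {H : Subgroup (Equiv.Perm B)}
    {X : Subgroup (Equiv.Perm (Fin n))} {g : Equiv.Perm (B × Fin n)} (hg : InWreath H X g)
    {p : B × Fin n} {i : Fin n} (hp : p.2 = i) (hgp : (g p).2 = i) : g ∈ blockStab B i := by
  refine mem_blockStab_iff.2 fun q => ?_
  simpa [hp, hgp] using hg.snd_apply_eq_iff q p

/-- If a group preserving a nontrivial block system has rank 3, then it is transitive on pairs of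
points lying in different blocks. -/
theorem exists_mem_apply_eq_of_snd_ne {α ι : Type*} [Nontrivial α] {H : Subgroup (Equiv.Perm α)}
    {X : Subgroup (Equiv.Perm ι)} {G : Subgroup (Equiv.Perm (α × ι))}
    (hG : ∀ g ∈ G, InWreath H X g)
    (hrank3 : Nat.card (MulAction.orbitRel.Quotient G ((α × ι) × (α × ι))) = 3)
    {p q r s : α × ι} (hpq : p.2 ≠ q.2) (hrs : r.2 ≠ s.2) : ∃ g ∈ G, g p = r ∧ g q = s := by
  classical
  let mk : (α × ι) × (α × ι) → MulAction.orbitRel.Quotient G ((α × ι) × (α × ι)) :=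
    fun x => Quotient.mk _ x
  have hmk : ∀ x y, mk x = mk y → ∃ g ∈ G, g y.1 = x.1 ∧ g y.2 = x.2 := by
    intro x y hxy
    obtain ⟨g, hg⟩ := MulAction.orbitRel_apply.1 (Quotient.exact hxy)
    exact ⟨g, g.2, congrArg Prod.fst hg, congrArg Prod.snd hg⟩
  obtain ⟨b, hb⟩ := exists_ne p.1
  have hDS : mk (p, p) ≠ mk (p, (b, p.2)) := by
    intro h
    obtain ⟨g, -, h₁, h₂⟩ := hmk _ _ h
    exact hb (congrArg Prod.fst (g.injective (h₂.trans h₁.symm)))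
  have key : ∀ x y z w : α × ι, x.2 = y.2 → z.2 ≠ w.2 → mk (x, y) ≠ mk (z, w) := by
    intro x y z w hxy hzw h
    obtain ⟨g, hg, h₁, h₂⟩ := hmk _ _ h
    refine hzw (((hG g hg).snd_apply_eq_iff z w).1 ?_)
    rw [h₁, h₂]
    exact hxy
  by_contra hne
  have hT : mk (r, s) ≠ mk (p, q) := fun h => hne (hmk _ _ h)
  have : Finite (MulAction.orbitRel.Quotient G ((α × ι) × (α × ι))) :=
    Nat.finite_of_card_ne_zero (by omega)
  have := Fintype.ofFinite (MulAction.orbitRel.Quotient G ((α × ι) × (α × ι)))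
  have hcard : ({mk (p, p), mk (p, (b, p.2)), mk (r, s), mk (p, q)} : Finset _).card = 4 := by
    simp [Finset.card_insert_of_notMem, hDS, hT, key p p r s rfl hrs, key p p p q rfl hpq,
      key p (b, p.2) r s rfl hrs, key p (b, p.2) p q rfl hpq]
  have hle := Finset.card_le_univ
    ({mk (p, p), mk (p, (b, p.2)), mk (r, s), mk (p, q)} : Finset _)
  rw [← Nat.card_eq_fintype_card, hrank3, hcard] at hle
  omega

/-- suppose `G` satisfies Hypothesis (*) with blocks `B × {i}` and `G`
has rank 3. Then for a block `Bᵢ`, a point `v ∈ Bᵢ` and another block `Bⱼ` (`j ≠ i`):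
(E) the subgroups `G_{Bᵢ,v}` and `G_{Bᵢ,Bⱼ}` are not conjugate in `G_{Bᵢ}` (the action
of `G_{Bᵢ}` on the block is not isomorphic to its action on the remaining blocks); and
(F) there is no normal subgroup `N` of `G` with `G_v = G_{Bᵢ} ∩ N`. -/
theorem stmt_16 {B : Type*} [Fintype B] {n : ℕ} (hn : 2 ≤ n)
    (H : Subgroup (Equiv.Perm B)) (X : Subgroup (Equiv.Perm (Fin n)))
    (hH : Is2Trans H) (hX : Is2Trans X)
    (G : Subgroup (Equiv.Perm (B × Fin n)))
    (hGw : ∀ g ∈ G, InWreath H X g)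
    (hproj : ProjEq G X)
    (hcomp : ComponentEq G (⟨0, by omega⟩ : Fin n) H)
    (hrank3 : Nat.card
      (MulAction.orbitRel.Quotient G ((B × Fin n) × (B × Fin n))) = 3)
    (i j : Fin n) (hij : j ≠ i) (v : B) :
    (∀ g : ↥(G ⊓ blockStab B i),
      Subgroup.map (MulAut.conj g).toMonoidHom
        (Subgroup.comap (G ⊓ blockStab B i).subtype
          (MulAction.stabilizer (Equiv.Perm (B × Fin n)) ((v, i) : B × Fin n))) ≠
      Subgroup.comap (G ⊓ blockStab B i).subtype (blockStab B j)) ∧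
    ¬ ∃ N : Subgroup (Equiv.Perm (B × Fin n)), NormalIn N G ∧
        G ⊓ MulAction.stabilizer (Equiv.Perm (B × Fin n)) ((v, i) : B × Fin n) =
          G ⊓ blockStab B i ⊓ N := by
  have := hH.1
  have htrans {p q r s : B × Fin n} (hpq : p.2 ≠ q.2) (hrs : r.2 ≠ s.2) :
      ∃ g ∈ G, g p = r ∧ g q = s := exists_mem_apply_eq_of_snd_ne hGw hrank3 hpq hrs
  constructor
  · rintro ⟨g, hgG, hgi⟩ heq
    obtain ⟨w, hw⟩ : ∃ w, g (v, i) = (w, i) :=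
      ⟨(g (v, i)).1, Prod.ext rfl ((mem_blockStab_iff.1 hgi _).2 rfl)⟩
    obtain ⟨u, hu⟩ := exists_ne w
    obtain ⟨x, hxG, hxi, hxj⟩ := htrans (p := (w, i)) (q := (w, j)) (r := (u, i)) (s := (w, j))
      hij.symm hij.symm
    have hx : x ∈ G ⊓ blockStab B i :=
      ⟨hxG, (hGw x hxG).mem_blockStab (p := (w, i)) rfl (by rw [hxi])⟩
    have hxmem : (⟨x, hx⟩ : ↥(G ⊓ blockStab B i)) ∈
        Subgroup.comap (G ⊓ blockStab B i).subtype (blockStab B j) :=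
      (hGw x hxG).mem_blockStab (p := (w, j)) rfl (by rw [hxj])
    rw [← heq] at hxmem
    obtain ⟨⟨y, hy⟩, hyv, hyx⟩ := hxmem
    have hyv' : y (v, i) = (v, i) := hyv
    have hyx' : g * y * g⁻¹ = x := congrArg Subtype.val hyx
    have hfix : x (w, i) = (w, i) := by
      rw [← hyx', ← hw]
      simp [hyv']
    exact hu (congrArg Prod.fst (hxi.symm.trans hfix))
  · rintro ⟨N, ⟨-, hN⟩, heq⟩
    obtain ⟨u, hu⟩ := exists_ne v
    obtain ⟨g, hgG, hgi, hgj⟩ := htrans (p := (v, i)) (q := (v, j)) (r := (v, i)) (s := (u, j))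
      hij.symm hij.symm
    obtain ⟨h, hhG, hh, -⟩ := htrans (p := (v, j)) (q := (v, i)) (r := (v, i)) (s := (v, j))
      hij hij.symm
    have hh' : h⁻¹ (v, i) = (v, j) := by rw [← hh]; simp
    have hgN : g ∈ N := (heq.le ⟨hgG, hgi⟩).2
    have hcG : h * g * h⁻¹ ∈ G := G.mul_mem (G.mul_mem hhG hgG) (G.inv_mem hhG)
    have hci : h * g * h⁻¹ ∈ blockStab B i := by
      refine (hGw _ hcG).mem_blockStab (p := (v, i)) rfl ?_
      have := ((hGw h hhG).snd_apply_eq_iff (u, j) (v, j)).2 rfl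
      rwa [hh, ← hgj, ← hh'] at this
    have hfix : (h * g * h⁻¹) (v, i) = (v, i) := (heq.ge ⟨⟨hcG, hci⟩, hN h hhG g hgN⟩).2
    have hgfix : g (v, j) = (v, j) := by
      rw [Equiv.Perm.mul_apply, Equiv.Perm.mul_apply, hh'] at hfix
      exact h.injective (hfix.trans hh.symm)
    exact hu (congrArg Prod.fst (hgj.symm.trans hgfix))
end
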